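/- arXiv:math/0306396 — 5 statements merged into one kernel-verified Lean document; each statement's English description precedes it below -/
import Mathlib

section
/- Let n be even and A an n×n skew-symmetric matrix over R. Then the Berezin integral ∫ dχ₁⋯dχₙ exp(−½ χAχ), where χAχ = Σ_{i,j} χᵢ Aᵢⱼ χⱼ, equals the Pfaffian of A. -/
set_option synthInstance.maxHeartbeats 1000000
set_option maxHeartbeats 1000000

noncomputable section

variable {R : Type*} [CommRing R] [Algebra ℚ R]

/-- The Grassmann algebra on anticommuting generators indexed by `ι`,
realized as the exterior algebra of the free module `ι → R`. -/
abbrev GA (R : Type*) [CommRing R] (ι : Type*) : Type _ :=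
  ExteriorAlgebra R (ι → R)

/-- The generator `χ i` of the Grassmann algebra. -/
def gaGen {R : Type*} [CommRing R] {ι : Type*} [DecidableEq ι] (i : ι) : GA R ι :=
  ExteriorAlgebra.ι R (Pi.single i 1)

/-- The odd derivation `∂/∂χ i` (left contraction with the `i`-th coordinate functional). -/
def gaDeriv {R : Type*} [CommRing R] {ι : Type*} [DecidableEq ι] (i : ι) :
    GA R ι →ₗ[R] GA R ι :=
  CliffordAlgebra.contractLeft (Q := (0 : QuadraticForm R (ι → R))) (LinearMap.proj i)

/-- Iterated Berezin integration: `bint [τ 1, …, τ p] f = ∂/∂χ_{τ 1} ∘ ⋯ ∘ ∂/∂χ_{τ p} f`. -/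
def bint {R : Type*} [CommRing R] {ι : Type*} [DecidableEq ι] :
    List ι → GA R ι → GA R ι
  | [], f => f
  | i :: t, f => gaDeriv i (bint t f)

/-- The scalar (degree-0) part of an element of the Grassmann algebra. -/
def gaCoef {R : Type*} [CommRing R] {ι : Type*} : GA R ι →ₐ[R] R :=
  ExteriorAlgebra.algebraMapInv

/-- The (terminating) exponential of an element of the augmentation ideal of the
Grassmann algebra on finitely many generators. -/
def gexp {R : Type*} [CommRing R] [Algebra ℚ R] {ι : Type*} [Fintype ι] (f : GA R ι) :
    GA R ι :=
  ∑ p ∈ Finset.range (Fintype.card ι + 1), algebraMap ℚ R (p.factorial : ℚ)⁻¹ • f ^ p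


/-- The Pfaffian of a `2m × 2m` matrix, `Pf(A) = (2^m m!)⁻¹ Σ_σ ε(σ) Π_i A_{σ(2i-1) σ(2i)}`. -/
def pf {R : Type*} [CommRing R] [Algebra ℚ R] {m : ℕ}
    (A : Matrix (Fin (2 * m)) (Fin (2 * m)) R) : R :=
  algebraMap ℚ R ((2 ^ m * m.factorial : ℚ))⁻¹ *
    ∑ σ : Equiv.Perm (Fin (2 * m)), (Equiv.Perm.sign σ : ℤ) •
      ∏ i : Fin m, A (σ ⟨2 * (i : ℕ), by omega⟩) (σ ⟨2 * (i : ℕ) + 1, by omega⟩)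


section helpers

variable {S : Type*} [CommRing S]

theorem gaDeriv_gen_mul {ι : Type*} [DecidableEq ι] (i j : ι) (x : GA S ι) :
    gaDeriv i (gaGen j * x) = (Pi.single j 1 : ι → S) i • x - gaGen j * gaDeriv i x := by
  exact CliffordAlgebra.contractLeft_ι_mul _ _ _

theorem gaDeriv_one {ι : Type*} [DecidableEq ι] (i : ι) :
    gaDeriv i (1 : GA S ι) = 0 := by
  exact CliffordAlgebra.contractLeft_one _ _

theorem gaDeriv_mem {ι : Type*} [DecidableEq ι] (i : ι) (k : ℕ) (f : GA S ι)
    (hf : f ∈ (LinearMap.range (ExteriorAlgebra.ι S : (ι → S) →ₗ[S] GA S ι)) ^ (k + 1)) :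
    gaDeriv i f ∈ (LinearMap.range (ExteriorAlgebra.ι S : (ι → S) →ₗ[S] GA S ι)) ^ k := by
  induction k generalizing f with
  | zero =>
    rw [zero_add, pow_one] at hf
    obtain ⟨v, rfl⟩ := hf
    rw [pow_zero]
    have : gaDeriv i (ExteriorAlgebra.ι S v) = algebraMap S (GA S ι) (v i) := 
      CliffordAlgebra.contractLeft_ι _ _ _
    rw [this]
    exact Submodule.algebraMap_mem _
  | succ k ih =>
    rw [pow_succ'] at hf
    induction hf using Submodule.mul_induction_on' with
    | mem_mul_mem m hm n hn =>
      obtain ⟨v, rfl⟩ := hm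
      have : gaDeriv i (ExteriorAlgebra.ι S v * n) = v i • n - ExteriorAlgebra.ι S v * gaDeriv i n :=
        CliffordAlgebra.contractLeft_ι_mul _ _ _
      rw [this]
      refine Submodule.sub_mem _ (Submodule.smul_mem _ _ hn) ?_
      rw [pow_succ']
      exact Submodule.mul_mem_mul ⟨v, rfl⟩ (ih n hn)
    | add x hx y hy h1 h2 =>
      rw [map_add]
      exact Submodule.add_mem _ h1 h2

theorem gaDeriv_zero_mem {ι : Type*} [DecidableEq ι] (i : ι) (f : GA S ι)
    (hf : f ∈ (LinearMap.range (ExteriorAlgebra.ι S : (ι → S) →ₗ[S] GA S ι)) ^ 0) :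
    gaDeriv i f = 0 := by
  rw [pow_zero] at hf
  obtain ⟨r, rfl⟩ := Submodule.mem_one.1 hf
  exact CliffordAlgebra.contractLeft_algebraMap _ _ _

theorem bint_mem {ι : Type*} [DecidableEq ι] (l : List ι) (k : ℕ) (f : GA S ι)
    (hf : f ∈ (LinearMap.range (ExteriorAlgebra.ι S : (ι → S) →ₗ[S] GA S ι)) ^ k) :
    (k < l.length → bint l f = 0) ∧ (l.length ≤ k → bint l f ∈
      (LinearMap.range (ExteriorAlgebra.ι S : (ι → S) →ₗ[S] GA S ι)) ^ (k - l.length)) := by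
  induction l with
  | nil => simpa [bint] using hf
  | cons a t ih =>
    simp only [bint, List.length_cons]
    constructor
    · intro h
      rcases Nat.lt_or_ge k t.length with h1 | h1
      · rw [ih.1 h1, map_zero]
      · have := ih.2 h1
        rw [show k - t.length = 0 by omega] at this
        exact gaDeriv_zero_mem a _ this
    · intro h
      have := ih.2 (by omega)
      rw [show k - t.length = k - (t.length + 1) + 1 by omega] at this
      exact gaDeriv_mem a _ _ this

theorem gaCoef_mem {ι : Type*} (k : ℕ) (hk : k ≠ 0) (f : GA S ι)
    (hf : f ∈ (LinearMap.range (ExteriorAlgebra.ι S : (ι → S) →ₗ[S] GA S ι)) ^ k) :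
    gaCoef f = 0 := by
  obtain ⟨k, rfl⟩ := Nat.exists_eq_succ_of_ne_zero hk
  rw [Nat.succ_eq_add_one, pow_succ'] at hf
  induction hf using Submodule.mul_induction_on' with
  | mem_mul_mem m hm n hn =>
    obtain ⟨v, rfl⟩ := hm
    rw [map_mul]
    have : gaCoef (ExteriorAlgebra.ι S v) = 0 := by
      simp [gaCoef, ExteriorAlgebra.algebraMapInv]
    rw [this, zero_mul]
  | add x hx y hy h1 h2 => rw [map_add, h1, h2, add_zero]

theorem gaCoef_bint_ne {ι : Type*} [DecidableEq ι] (l : List ι) (k : ℕ) (f : GA S ι)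
    (hf : f ∈ (LinearMap.range (ExteriorAlgebra.ι S : (ι → S) →ₗ[S] GA S ι)) ^ k)
    (hk : k ≠ l.length) : gaCoef (bint l f) = 0 := by
  rcases lt_or_gt_of_ne hk with h | h
  · rw [(bint_mem l k f hf).1 h, map_zero]
  · exact gaCoef_mem _ (by omega) _ ((bint_mem l k f hf).2 h.le)

/-- `bint` as a linear map. -/
def bintL {ι : Type*} [DecidableEq ι] : List ι → (GA S ι →ₗ[S] GA S ι)
  | [] => LinearMap.id
  | i :: t => (gaDeriv i).comp (bintL t)

theorem bintL_apply {ι : Type*} [DecidableEq ι] (l : List ι) (f : GA S ι) :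
    bintL l f = bint l f := by
  induction l with
  | nil => rfl
  | cons a t ih => simp [bintL, bint, ih]

theorem bint_append {ι : Type*} [DecidableEq ι] (l l' : List ι) (f : GA S ι) :
    bint (l ++ l') f = bint l (bint l' f) := by
  induction l with
  | nil => rfl
  | cons a t ih => simp [bint, ih]

theorem gaDeriv_prod {ι : Type*} [DecidableEq ι] (l : List ι) (a : ι) (ha : a ∉ l) :
    gaDeriv a ((l.map (gaGen (R := S))).prod * gaGen a) =
      (-1 : S) ^ l.length • (l.map (gaGen (R := S))).prod := by
  induction l with
  | nil =>
    have := gaDeriv_gen_mul (S := S) a a 1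
    rw [gaDeriv_one] at this
    simpa using this
  | cons b t ih =>
    simp only [List.mem_cons, not_or] at ha
    simp only [List.map_cons, List.prod_cons, List.length_cons, mul_assoc]
    rw [gaDeriv_gen_mul, ih ha.2, Pi.single_eq_of_ne ha.1, zero_smul, zero_sub, pow_succ,
      mul_smul_comm]
    simp

theorem bint_prod {ι : Type*} [DecidableEq ι] (l : List ι) (hl : l.Nodup) :
    bint l ((l.map (gaGen (R := S))).prod) =
      (-1 : S) ^ (l.length * (l.length - 1) / 2) • (1 : GA S ι) := by
  induction l using List.reverseRecOn with
  | nil => simp [bint]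
  | append_singleton t a ih =>
    have h1 : t.Nodup := (List.nodup_append.1 hl).1
    have h2 : a ∉ t := by
      have := (List.nodup_append.1 hl).2.2
      intro h
      exact this a h a (by simp) rfl
    rw [bint_append]
    simp only [List.map_append, List.map_cons, List.map_nil, List.prod_append, List.prod_cons,
      List.prod_nil, mul_one, List.length_append, List.length_cons, List.length_nil, zero_add]
    simp only [bint]
    rw [gaDeriv_prod t a h2, ← bintL_apply, map_smul, bintL_apply, ih h1, smul_smul, ← pow_add,
      ← Finset.sum_range_id, ← Finset.sum_range_id, Finset.sum_range_succ, add_comm]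

theorem sum_pow_ofFn {T X : Type*} [Semiring T] [Fintype X] (f : X → T) (p : ℕ) :
    (∑ x, f x) ^ p = ∑ v : Fin p → X, (List.ofFn fun i => f (v i)).prod := by
  induction p with
  | zero => simp
  | succ p ih =>
    rw [pow_succ', ih, Finset.sum_mul_sum, ← Fintype.sum_prod_type',
      ← (Fin.consEquiv (fun _ : Fin (p + 1) => X)).sum_comp]
    refine Finset.sum_congr rfl fun x _ => ?_
    simp [List.ofFn_succ, Fin.consEquiv]

/-- Pairing up consecutive indices. -/
def pairEquiv (m : ℕ) (X : Type*) : (Fin (2 * m) → X) ≃ (Fin m → X × X) where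
  toFun w i := (w ⟨2 * (i : ℕ), by omega⟩, w ⟨2 * (i : ℕ) + 1, by omega⟩)
  invFun v k := if (k : ℕ) % 2 = 0 then (v ⟨k / 2, by omega⟩).1 else (v ⟨k / 2, by omega⟩).2
  left_inv w := by
    funext k
    dsimp only
    split_ifs with h
    · congr 1; ext; simp only; omega
    · congr 1; ext; simp only; omega
  right_inv v := by
    funext i
    have h1 : (2 * (i : ℕ) + 1) / 2 = i := by omega
    have h2 : (2 * (i : ℕ) + 1) % 2 ≠ 0 := by omega
    simp [h1]

theorem ofFn_smul_prod {T : Type*} [Ring T] [Algebra S T] (m : ℕ) (a : Fin m → S)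
    (b : Fin m → T) : (List.ofFn fun i => a i • b i).prod = (∏ i, a i) • (List.ofFn b).prod := by
  induction m with
  | zero => simp
  | succ m ih =>
    simp only [List.ofFn_succ, List.prod_cons, Fin.prod_univ_succ]
    rw [ih, smul_mul_smul_comm]

theorem ofFn_pair_prod {T : Type*} [Monoid T] (m : ℕ) (g : Fin (2 * m) → T) :
    (List.ofFn fun i : Fin m => g ⟨2 * (i : ℕ), by omega⟩ * g ⟨2 * (i : ℕ) + 1, by omega⟩).prod
      = (List.ofFn g).prod := by
  rw [List.ofFn_mul', List.prod_flatten, List.map_ofFn]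
  congr 2
  funext i
  simp [List.ofFn_succ]

/-- The Berezin functional as an alternating map. -/
def berAlt (S : Type*) [CommRing S] (n : ℕ) : (Fin n → S) [⋀^Fin n]→ₗ[S] S :=
  ((gaCoef (R := S) (ι := Fin n)).toLinearMap.comp (bintL (List.ofFn id))).compAlternatingMap
    (ExteriorAlgebra.ιMulti S n)

theorem berAlt_apply (n : ℕ) (w : Fin n → Fin n) :
    berAlt S n (fun i => Pi.single (w i) 1) =
      gaCoef (bint (List.ofFn id) (List.ofFn fun i => gaGen (R := S) (w i)).prod) := by
  simp only [berAlt, LinearMap.compAlternatingMap_apply, LinearMap.comp_apply, bintL_apply,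
    ExteriorAlgebra.ιMulti_apply]
  rfl

theorem berAlt_eq (n : ℕ) (w : Fin n → Fin n) :
    berAlt S n (fun i => Pi.single (w i) 1) =
      (-1 : S) ^ (n * (n - 1) / 2) *
        ∑ σ : Equiv.Perm (Fin n), if w = σ then ((Equiv.Perm.sign σ : ℤ) : S) else 0 := by
  rw [(berAlt S n).eq_smul_basis_det (Pi.basisFun S (Fin n))]
  rw [AlternatingMap.smul_apply, smul_eq_mul]
  congr 1
  · have := berAlt_apply (S := S) n id
    have e : (⇑(Pi.basisFun S (Fin n))) = fun i => Pi.single (id i) (1 : S) := by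
      funext i; simp
    rw [e, this]
    have h := bint_prod (S := S) (List.ofFn (id : Fin n → Fin n)) (List.nodup_ofFn.2 Function.injective_id)
    rw [List.map_ofFn, List.length_ofFn] at h
    have h' : (List.ofFn fun i => gaGen (R := S) (id i : Fin n)) = List.ofFn (gaGen ∘ id) := rfl
    rw [h', h]
    simp
  · rw [Module.Basis.det_apply, Matrix.det_apply']
    refine Finset.sum_congr rfl fun σ _ => ?_
    simp only [Module.Basis.toMatrix_apply, Pi.basisFun_repr]
    split_ifs with h
    · subst h; simp
    · obtain ⟨i, hi⟩ := Function.ne_iff.1 h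
      rw [Finset.prod_eq_zero (Finset.mem_univ i), mul_zero]
      exact Pi.single_eq_of_ne (Ne.symm hi) _

theorem gaCoef_bint_pow (m : ℕ) (A : Matrix (Fin (2 * m)) (Fin (2 * m)) S) :
    gaCoef (bint (List.ofFn id)
      ((∑ i : Fin (2 * m), ∑ j : Fin (2 * m), A i j • (gaGen i * gaGen j) :
            GA S (Fin (2 * m))) ^ m)) =
    (-1) ^ m * ∑ σ : Equiv.Perm (Fin (2 * m)), (Equiv.Perm.sign σ : ℤ) •
      ∏ i : Fin m, A (σ ⟨2 * (i : ℕ), by omega⟩) (σ ⟨2 * (i : ℕ) + 1, by omega⟩) := by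
  rw [← Fintype.sum_prod_type', sum_pow_ofFn, ← (pairEquiv m (Fin (2 * m))).sum_comp,
    ← bintL_apply, map_sum, map_sum]
  have key : ∀ w : Fin (2 * m) → Fin (2 * m),
      gaCoef (bintL (List.ofFn id) (List.ofFn fun i => 
        A (pairEquiv m (Fin (2 * m)) w i).1 (pairEquiv m (Fin (2 * m)) w i).2 •
          (gaGen (R := S) (pairEquiv m (Fin (2 * m)) w i).1 *
            gaGen (pairEquiv m (Fin (2 * m)) w i).2)).prod) =
      (-1) ^ m * ∑ σ : Equiv.Perm (Fin (2 * m)), if w = σ then ((Equiv.Perm.sign σ : ℤ) •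
        ∏ i : Fin m, A (w ⟨2 * (i : ℕ), by omega⟩) (w ⟨2 * (i : ℕ) + 1, by omega⟩)) else 0 := by
    intro w
    rw [ofFn_smul_prod, map_smul, map_smul, bintL_apply]
    have h1 := ofFn_pair_prod m (fun k => gaGen (R := S) (w k))
    have h2 := berAlt_eq (S := S) (2 * m) w
    rw [berAlt_apply, ← h1] at h2
    simp only [pairEquiv, Equiv.coe_fn_mk] at *
    rw [h2, smul_eq_mul]
    have h3 : (-1 : S) ^ (2 * m * (2 * m - 1) / 2) = (-1) ^ m := by
      rw [mul_assoc, Nat.mul_div_cancel_left _ (by norm_num), pow_mul]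
      rcases Nat.eq_zero_or_pos m with rfl | hm
      · simp
      · rcases Nat.even_or_odd m with he | ho
        · rw [he.neg_one_pow, one_pow]
        · rw [ho.neg_one_pow]
          exact Odd.neg_one_pow ⟨m - 1, by omega⟩
    rw [h3, mul_left_comm, Finset.mul_sum]
    congr 1
    refine Finset.sum_congr rfl fun σ _ => ?_
    split_ifs
    · rw [zsmul_eq_mul, mul_comm]
    · rw [mul_zero]
  rw [Finset.sum_congr rfl fun w _ => key w, ← Finset.mul_sum, Finset.sum_comm]
  congr 1
  refine Finset.sum_congr rfl fun σ _ => ?_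
  rw [Finset.sum_ite_eq' Finset.univ (σ : Fin (2 * m) → Fin (2 * m))]
  simp

theorem quad_mem (n : ℕ) (A : Matrix (Fin n) (Fin n) S) (p : ℕ) :
    (∑ i : Fin n, ∑ j : Fin n, A i j • (gaGen i * gaGen j) : GA S (Fin n)) ^ p ∈
      (LinearMap.range (ExteriorAlgebra.ι S : (Fin n → S) →ₗ[S] GA S (Fin n))) ^ (2 * p) := by
  rw [pow_mul]
  refine Submodule.pow_mem_pow _ ?_ p
  refine Submodule.sum_mem _ fun i _ => Submodule.sum_mem _ fun j _ => Submodule.smul_mem _ _ ?_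
  rw [pow_two]
  exact Submodule.mul_mem_mul ⟨_, rfl⟩ ⟨_, rfl⟩

end helpers

/-- For an even number `n = 2m` of generators and a skew-symmetric `n × n` matrix `A`,
the Berezin integral `∫ dχ_1 ⋯ dχ_n exp(-½ χAχ)` equals the Pfaffian of `A`. -/
theorem berezin_pfaffian (m : ℕ) (A : Matrix (Fin (2 * m)) (Fin (2 * m)) R)
    (hA : A.transpose = -A) :
    gaCoef (bint (List.ofFn id)
        (gexp (algebraMap ℚ R (-(1/2 : ℚ)) •
          ((∑ i : Fin (2 * m), ∑ j : Fin (2 * m), A i j • (gaGen i * gaGen j)) :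
            GA R (Fin (2 * m)))))) = pf A := by
  unfold gexp pf
  rw [← bintL_apply, map_sum, map_sum, Finset.sum_eq_single m]
  · rw [smul_pow, map_smul, map_smul, map_smul, map_smul, bintL_apply, gaCoef_bint_pow,
      smul_eq_mul, smul_eq_mul, ← map_pow, ← mul_assoc, ← mul_assoc, ← map_mul]
    congr 1
    have : ((-1 : R)) ^ m = algebraMap ℚ R ((-1) ^ m) := by simp
    rw [this, ← map_mul]
    congr 1
    rw [mul_assoc, ← mul_pow, mul_inv, ← inv_pow]
    norm_num
    ring
  · intro p _ hp
    rw [smul_pow, map_smul, map_smul, map_smul, map_smul, bintL_apply,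
      gaCoef_bint_ne _ (2 * p) _ (quad_mem _ A p) (by simp; omega), smul_zero, smul_zero]
  · intro h
    exact absurd (Finset.mem_range.2 (by simp; omega)) h
end
end

section
/- Let A be an m×m matrix over R, 0 ≤ p ≤ m, and I = {i₁ < ⋯ < i_p}, J = {j₁ < ⋯ < j_p} two p-element subsets of {1,…,m}. Then ∫ (dψ̄ dψ)_ent ψ_{j₁}ψ̄_{i₁} ψ_{j₂}ψ̄_{i₂} ⋯ ψ_{j_p}ψ̄_{i_p} exp(−ψ̄Aψ) = (−1)^{ΣI + ΣJ} det(A_{I^c, J^c}), where ΣI = i₁+⋯+i_p, ΣJ = j₁+⋯+j_p, and A_{I^c,J^c} is the (m−p)×(m−p) submatrix obtained by deleting rows indexed by I and columns indexed by J. -/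
set_option synthInstance.maxHeartbeats 1000000
set_option maxHeartbeats 1000000

noncomputable section

variable {R : Type*} [CommRing R] [Algebra ℚ R]

/-- The generator `ψ i` in the Grassmann algebra on `2m` generators. -/
def psi {R : Type*} [CommRing R] {m : ℕ} (i : Fin m) : GA R (Fin m ⊕ Fin m) :=
  gaGen (Sum.inl i)

/-- The generator `ψ̄ i` in the Grassmann algebra on `2m` generators. -/
def psibar {R : Type*} [CommRing R] {m : ℕ} (i : Fin m) : GA R (Fin m ⊕ Fin m) :=
  gaGen (Sum.inr i)

/-- The entangled order of Berezin integration `dψ̄₁ dψ₁ dψ̄₂ dψ₂ ⋯ dψ̄_m dψ_m`. -/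
def entList (m : ℕ) : List (Fin m ⊕ Fin m) :=
  (List.ofFn (fun i : Fin m => [Sum.inr i, Sum.inl i])).flatten

/-- The quadratic element `ψ̄ A ψ = Σ_{i,j} ψ̄ᵢ Aᵢⱼ ψⱼ`. -/
def quadPsi {R : Type*} [CommRing R] {m : ℕ} (A : Matrix (Fin m) (Fin m) R) :
    GA R (Fin m ⊕ Fin m) :=
  ∑ i : Fin m, ∑ j : Fin m, A i j • (psibar i * psi j)


open Finset in
theorem bm_sign {p n : ℕ} (I : Finset (Fin (p + n))) (hI : I.card = p) (hIc : Iᶜ.card = n) :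
    ((Equiv.Perm.sign (finSumFinEquiv.symm.trans (finSumEquivOfFinset hI hIc)) : ℤˣ) : ℤˣ) =
      (-1) ^ (∑ i ∈ I, (i : ℕ)) * (-1) ^ (∑ k : Fin p, (k : ℕ)) := by
  rw [Equiv.Perm.sign_eq_prod_prod_Ioi]
  have h1 : ∀ i : Fin (p+n), ∀ f : Fin (p+n) → ℤˣ, ∏ j ∈ Finset.Ioi i, f j =
      ∏ j, if i < j then f j else 1 := by
    intro i f
    rw [← Finset.prod_filter]
    congr 1
    ext; simp
  simp_rw [h1]
  simp_rw [← finSumFinEquiv.prod_comp, Fintype.prod_sum_type]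
  have key : ∀ k : Fin p, (∏ l : Fin n, if I.orderEmbOfFin hI k < Iᶜ.orderEmbOfFin hIc l then (1:ℤˣ) else -1)
      = (-1) ^ ((I.orderEmbOfFin hI k : Fin (p+n)) : ℕ) * (-1) ^ (k : ℕ) := by
    intro k
    set a := I.orderEmbOfFin hI k with ha
    have haI : a ∈ I := Finset.orderEmbOfFin_mem _ _ _
    have e1 : (∏ l : Fin n, if a < Iᶜ.orderEmbOfFin hIc l then (1:ℤˣ) else -1) =
        ∏ x ∈ Iᶜ, if a < x then (1:ℤˣ) else -1 := by
      conv_rhs => rw [← Finset.map_orderEmbOfFin_univ Iᶜ hIc, Finset.prod_map]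
      rfl
    have e2 : (∏ x ∈ Iᶜ, if a < x then (1:ℤˣ) else -1) = (-1) ^ #{x ∈ Iᶜ | x < a} := by
      rw [Finset.prod_ite]
      simp only [Finset.prod_const, one_pow, one_mul]
      congr 2
      ext x
      simp only [Finset.mem_filter, Finset.mem_compl, not_lt]
      constructor
      · rintro ⟨h, h'⟩
        refine ⟨h, lt_of_le_of_ne h' ?_⟩
        rintro rfl; exact h haI
      · rintro ⟨h, h'⟩; exact ⟨h, h'.le⟩
    have e3 : #{x ∈ I | x < a} = k := by
      have : ({x ∈ I | x < a} : Finset _) = (Finset.Iio k).map (I.orderEmbOfFin hI).toEmbedding := by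
        ext x
        simp only [Finset.mem_filter, Finset.mem_map, Finset.mem_Iio]
        constructor
        · rintro ⟨h, h'⟩
          have : x ∈ Finset.map (I.orderEmbOfFin hI).toEmbedding Finset.univ := by
            rw [Finset.map_orderEmbOfFin_univ]; exact h
          obtain ⟨l, -, rfl⟩ := Finset.mem_map.1 this
          exact ⟨l, by simpa [ha] using h', rfl⟩
        · rintro ⟨l, hl, rfl⟩
          exact ⟨Finset.orderEmbOfFin_mem _ _ _, by simpa [ha] using hl⟩
      rw [this]; simp
    have e4 : #{x ∈ I | x < a} + #{x ∈ Iᶜ | x < a} = a := by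
      rw [← Finset.card_union_of_disjoint, ← Finset.filter_union, Finset.union_compl]
      · have : (Finset.univ.filter (fun x : Fin (p+n) => x < a)) = Finset.Iio a := by ext; simp
        rw [this]; simp
      · exact Finset.disjoint_filter_filter disjoint_compl_right
    rw [e1, e2, ← e4, e3, pow_add, mul_right_comm, ← mul_pow]
    simp
  have h2 : ∀ (k : Fin p) (l : Fin n),
      (finSumFinEquiv (Sum.inl k) : Fin (p + n)) < finSumFinEquiv (Sum.inr l) := by
    intro k l; rw [Fin.lt_def]; simp; omega
  have h3 : ∀ (k : Fin p) (l : Fin n),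
      ¬ (finSumFinEquiv (Sum.inr l) : Fin (p + n)) < finSumFinEquiv (Sum.inl k) := by
    intro k l; rw [Fin.lt_def]; simp; omega
  have h4 : ∀ (k k' : Fin p), (if (finSumFinEquiv (Sum.inl k) : Fin (p + n)) <
      finSumFinEquiv (Sum.inl k') then if k < k' then (1:ℤˣ) else -1 else 1) = 1 := by
    intro k k'
    have : (finSumFinEquiv (Sum.inl k) : Fin (p + n)) < finSumFinEquiv (Sum.inl k') ↔ k < k' := by
      rw [Fin.lt_def, Fin.lt_def]; simp
    split_ifs <;> tauto
  have h5 : ∀ (k k' : Fin n), (if (finSumFinEquiv (Sum.inr k) : Fin (p + n)) <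
      finSumFinEquiv (Sum.inr k') then if k < k' then (1:ℤˣ) else -1 else 1) = 1 := by
    intro k k'
    have : (finSumFinEquiv (Sum.inr k) : Fin (p + n)) < finSumFinEquiv (Sum.inr k') ↔ k < k' := by
      rw [Fin.lt_def, Fin.lt_def]; simp
    split_ifs <;> tauto
  simp only [Equiv.trans_apply, Equiv.symm_apply_apply, finSumEquivOfFinset_inl,
    finSumEquivOfFinset_inr, h2, h3,
    if_true, if_false, OrderEmbedding.lt_iff_lt, h4, h5, Finset.prod_const_one, one_mul, mul_one, key]
  rw [Finset.prod_mul_distrib, Finset.prod_pow_eq_pow_sum, Finset.prod_pow_eq_pow_sum]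
  congr 2
  conv_rhs => rw [← Finset.map_orderEmbOfFin_univ I hI, Finset.sum_map]
  rfl

theorem bm_det {p n : ℕ} (A B : Matrix (Fin (p + n)) (Fin (p + n)) R)
    (I J : Finset (Fin (p + n))) (hI : I.card = p) (hIc : Iᶜ.card = n)
    (hJ : J.card = p) (hJc : Jᶜ.card = n)
    (hB1 : ∀ k, B (I.orderEmbOfFin hI k) = Pi.single (J.orderEmbOfFin hJ k) 1)
    (hB2 : ∀ i, i ∉ I → B i = A i) :
    B.det = (-1 : R) ^ ((∑ i ∈ I, (i : ℕ)) + ∑ j ∈ J, (j : ℕ)) *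
      (A.submatrix (Iᶜ.orderEmbOfFin hIc) (Jᶜ.orderEmbOfFin hJc)).det := by
  have hblk : B.submatrix (finSumEquivOfFinset hI hIc) (finSumEquivOfFinset hJ hJc) =
      Matrix.fromBlocks 1 0 (B.submatrix (Iᶜ.orderEmbOfFin hIc) (J.orderEmbOfFin hJ))
        (A.submatrix (Iᶜ.orderEmbOfFin hIc) (Jᶜ.orderEmbOfFin hJc)) := by
    have hJne : ∀ k l, Jᶜ.orderEmbOfFin hJc l ≠ J.orderEmbOfFin hJ k := by
      intro k l h
      have h1 := Finset.orderEmbOfFin_mem Jᶜ hJc l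
      rw [h, Finset.mem_compl] at h1
      exact h1 (Finset.orderEmbOfFin_mem _ _ _)
    have hIn : ∀ l, Iᶜ.orderEmbOfFin hIc l ∉ I := by
      intro l
      have h1 := Finset.orderEmbOfFin_mem Iᶜ hIc l
      rwa [Finset.mem_compl] at h1
    ext x y
    rcases x with x | x <;> rcases y with y | y
    · simp [hB1, Matrix.one_apply, Pi.single_apply, eq_comm]
    · simp [hB1, Pi.single_apply, hJne]
    · simp
    · simp [hB2 _ (hIn x)]
  have hd := congrArg Matrix.det hblk
  rw [Matrix.det_fromBlocks_zero₁₂, Matrix.det_one, one_mul] at hd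
  rw [← hd]
  set eI := finSumFinEquiv.symm.trans (finSumEquivOfFinset hI hIc) with heI
  set eJ := finSumFinEquiv.symm.trans (finSumEquivOfFinset hJ hJc) with heJ
  have : (B.submatrix (finSumEquivOfFinset hI hIc) (finSumEquivOfFinset hJ hJc)) =
      (((B.submatrix eI id).submatrix id eJ)).submatrix finSumFinEquiv finSumFinEquiv := by
    ext x y; simp [heI, heJ]
  rw [this, Matrix.det_submatrix_equiv_self, Matrix.det_permute', Matrix.det_permute,
    heI, heJ, bm_sign, bm_sign]
  push_cast
  have hs : ∀ a : ℕ, (-1 : R)^a * (-1)^a = 1 := by intro a; rw [← mul_pow]; simp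
  set a := ∑ i ∈ I, (i : ℕ)
  set b := ∑ j ∈ J, (j : ℕ)
  set c := ∑ k : Fin p, (k : ℕ)
  rw [pow_add]
  calc B.det = ((-1 : R)^a * (-1)^a) * ((-1 : R)^b * (-1)^b) * ((-1 : R)^c * (-1)^c) * B.det := by
        rw [hs, hs, hs]; ring
    _ = _ := by ring

theorem bm_exp {S : Type*} [CommRing S] [Algebra R S] {α : Type*} (s : Finset α) (x : α → S)
    (hx : ∀ i, x i * x i = 0) : ∀ N : ℕ, s.card ≤ N →
    ∑ q ∈ Finset.range (N + 1), algebraMap ℚ R (q.factorial : ℚ)⁻¹ • (∑ i ∈ s, x i) ^ q =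
      ∏ i ∈ s, (1 + x i) := by
  classical
  have hp : ∀ (a y : S), a * a = 0 → ∀ q : ℕ, (a + y) ^ (q + 1) = y ^ (q + 1) + (q + 1 : ℕ) • (a * y ^ q) := by
    intro a y ha q
    induction q with
    | zero => simp [add_comm]
    | succ q ih =>
      rw [pow_succ, ih]
      simp only [nsmul_eq_mul]
      push_cast
      linear_combination ((q:S) + 1) * y ^ q * ha
  induction s using Finset.induction_on with
  | empty => intro N _; rw [Finset.sum_range_succ']; simp
  | insert a s has ih =>
    intro N hN
    rw [Finset.card_insert_of_notMem has] at hN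
    obtain ⟨N, rfl⟩ : ∃ M, N = M + 1 := ⟨N - 1, by omega⟩
    rw [Finset.sum_insert has, Finset.prod_insert has, add_mul, one_mul]
    nth_rewrite 1 [← ih (N + 1) (by omega)]
    rw [← ih N (by omega), Finset.sum_range_succ', Finset.sum_range_succ' _ (N + 1),
      Finset.mul_sum]
    simp only [pow_zero]
    rw [add_right_comm, ← Finset.sum_add_distrib]
    congr 1
    refine Finset.sum_congr rfl fun q _ => ?_
    rw [hp _ _ (hx a), smul_add]
    congr 1
    rw [← Nat.cast_smul_eq_nsmul R, smul_smul, mul_smul_comm]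
    congr 1
    rw [← map_natCast (algebraMap ℚ R), ← map_mul]
    congr 1
    rw [Nat.factorial_succ]
    have := Nat.factorial_ne_zero q
    push_cast
    field_simp

theorem bm_core {S : Type*} [CommRing S] [Algebra R S] {m p : ℕ}
    (e : Fin m → (Fin m → R) →ₗ[R] S) (L : S →ₗ[R] R)
    (h1 : ∀ i v w, e i v * e i w = 0) (h2 : ∀ i j v, e i v * e j v = 0)
    (h3 : ∀ T : Finset (Fin m), T ≠ Finset.univ → ∀ v : Fin m → Fin m → R,
      L (∏ i ∈ T, e i (v i)) = 0)
    (h4 : L (∏ i, e i (Pi.single i 1)) = 1)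
    (A B : Fin m → Fin m → R)
    (I J : Finset (Fin m)) (hI : I.card = p) (hJ : J.card = p)
    (hB1 : ∀ k, B (I.orderEmbOfFin hI k) = Pi.single (J.orderEmbOfFin hJ k) 1)
    (hB2 : ∀ i, i ∉ I → B i = A i) (N : ℕ) (hN : m ≤ N) :
    L ((∏ k : Fin p, e (I.orderEmbOfFin hI k) (Pi.single (J.orderEmbOfFin hJ k) 1)) *
      ∑ q ∈ Finset.range (N + 1), algebraMap ℚ R (q.factorial : ℚ)⁻¹ •
        (∑ i, e i (A i)) ^ q) = Matrix.det (Matrix.of B) := by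
  rw [bm_exp Finset.univ (fun i => e i (A i)) (fun i => h1 i _ _) N (by simpa using hN)]
  have e1 : (∏ k : Fin p, e (I.orderEmbOfFin hI k) (Pi.single (J.orderEmbOfFin hJ k) 1)) =
      ∏ i ∈ I, e i (B i) := by
    conv_rhs => rw [← Finset.map_orderEmbOfFin_univ I hI, Finset.prod_map]
    exact Finset.prod_congr rfl fun k _ => by rw [← hB1]; rfl
  have e2 : (∏ i ∈ I, e i (B i)) * ∏ i, (1 + e i (A i)) =
      ∏ i, ((if i ∈ I then (0 : R) else 1) • (1 : S) + e i (B i)) := by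
    rw [← Finset.prod_mul_prod_compl I, ← Finset.prod_mul_prod_compl I (fun i => _ + _),
      ← mul_assoc, ← Finset.prod_mul_distrib]
    congr 1
    · exact Finset.prod_congr rfl fun i hi => by rw [mul_add, h1]; simp [hi]
    · refine Finset.prod_congr rfl fun i hi => ?_
      rw [Finset.mem_compl] at hi
      simp [hi, hB2]
  have e3 : L (∏ i, ((if i ∈ I then (0 : R) else 1) • (1 : S) + e i (B i))) =
      L (∏ i, e i (B i)) := by
    rw [Fintype.prod_add, map_sum, Finset.sum_eq_single ∅]
    · simp
    · intro T _ hT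
      rw [Finset.prod_smul, smul_mul_assoc, map_smul]
      simp only [Finset.prod_const_one, one_mul]
      rw [h3, smul_zero]
      simpa using hT
    · simp
  rw [e1, e2, e3]
  let f : (Fin m → R) [⋀^Fin m]→ₗ[R] R :=
    { L.compMultilinearMap ((MultilinearMap.mkPiAlgebra R (Fin m) S).compLinearMap e) with
      map_eq_zero_of_eq' := by
        intro v i j hv hij
        change L (∏ i, e i (v i)) = 0
        rw [← Finset.mul_prod_erase _ _ (Finset.mem_univ i),
          ← Finset.mul_prod_erase _ _ (Finset.mem_erase.2 ⟨hij.symm, Finset.mem_univ j⟩),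
          ← mul_assoc, hv, h2, zero_mul, map_zero] }
  have hf := congrArg (fun g => g B) (AlternatingMap.eq_smul_basis_det (Pi.basisFun R (Fin m)) f)
  have hf1 : f (Pi.basisFun R (Fin m)) = 1 := by
    rw [← h4]; change L (∏ i, e i _) = _
    simp
  rw [hf1, one_smul, Pi.basisFun_det] at hf
  exact hf

theorem bm_anti {ι : Type*} (v w : ι → R) :
    ExteriorAlgebra.ι R v * ExteriorAlgebra.ι R w =
      -(ExteriorAlgebra.ι R w * ExteriorAlgebra.ι R v) :=
  eq_neg_of_add_eq_zero_left (ExteriorAlgebra.ι_add_mul_swap v w)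

/-- The set of products of two generators. -/
def bmSet (R : Type*) [CommRing R] (ι : Type*) : Set (GA R ι) :=
  {x | ∃ v w : ι → R, x = ExteriorAlgebra.ι R v * ExteriorAlgebra.ι R w}

theorem bm_comm {ι : Type*} : ∀ a ∈ bmSet R ι, ∀ b ∈ bmSet R ι, a * b = b * a := by
  rintro _ ⟨a, b, rfl⟩ _ ⟨c, d, rfl⟩
  generalize ha : ExteriorAlgebra.ι R a = a'
  generalize hb : ExteriorAlgebra.ι R b = b'
  generalize hc : ExteriorAlgebra.ι R c = c'
  generalize hd : ExteriorAlgebra.ι R d = d'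
  have h1 : b' * c' = -(c' * b') := by subst hb hc; exact bm_anti _ _
  have h2 : a' * c' = -(c' * a') := by subst ha hc; exact bm_anti _ _
  have h3 : b' * d' = -(d' * b') := by subst hb hd; exact bm_anti _ _
  have h4 : a' * d' = -(d' * a') := by subst ha hd; exact bm_anti _ _
  calc a' * b' * (c' * d') = a' * (b' * c') * d' := by noncomm_ring
    _ = - ((a' * c') * (b' * d')) := by rw [h1]; noncomm_ring
    _ = - (c' * (a' * d') * b') := by rw [h2, h3]; noncomm_ring
    _ = c' * d' * (a' * b') := by rw [h4]; noncomm_ring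

/-- The even subalgebra. -/
abbrev bmS (R : Type*) [CommRing R] (ι : Type*) : Subalgebra R (GA R ι) :=
  Algebra.adjoin R (bmSet R ι)

instance bmSComm (R : Type*) [CommRing R] [Algebra ℚ R] (ι : Type*) : CommRing (bmS R ι) :=
  Algebra.adjoinCommRingOfComm R bm_comm

theorem bm_deriv {ι : Type*} [DecidableEq ι] (i : ι) (v : ι → R) (b : GA R ι) :
    gaDeriv i (ExteriorAlgebra.ι R v * b) = v i • b - ExteriorAlgebra.ι R v * gaDeriv i b :=
  CliffordAlgebra.contractLeft_ι_mul (Q := (0 : QuadraticForm R (ι → R))) _ v b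

theorem bm_deriv_pair {ι : Type*} [DecidableEq ι] (i : ι) (v w : ι → R) (hv : v i = 0)
    (hw : w i = 0) (b : GA R ι) :
    gaDeriv i (ExteriorAlgebra.ι R v * ExteriorAlgebra.ι R w * b) =
      ExteriorAlgebra.ι R v * ExteriorAlgebra.ι R w * gaDeriv i b := by
  rw [mul_assoc, bm_deriv, bm_deriv, hv, hw, zero_smul, zero_smul, zero_sub, zero_sub, mul_neg,
    neg_neg, mul_assoc]

theorem bm_deriv_one {ι : Type*} [DecidableEq ι] (i : ι) : gaDeriv i (1 : GA R ι) = 0 :=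
  CliffordAlgebra.contractLeft_one (Q := (0 : QuadraticForm R (ι → R))) _

theorem bm_deriv_comm {ι : Type*} [DecidableEq ι] (i j : ι) (x : GA R ι) :
    gaDeriv i (gaDeriv j x) = - gaDeriv j (gaDeriv i x) :=
  CliffordAlgebra.contractLeft_comm (Q := (0 : QuadraticForm R (ι → R))) _ _ x

theorem bm_deriv_sq {ι : Type*} [DecidableEq ι] (i : ι) (x : GA R ι) :
    gaDeriv i (gaDeriv i x) = 0 :=
  CliffordAlgebra.contractLeft_contractLeft (Q := (0 : QuadraticForm R (ι → R))) _ x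

/-- Linear version of `bint`. -/
def bmInt (R : Type*) [CommRing R] {ι : Type*} [DecidableEq ι] (l : List ι) : GA R ι →ₗ[R] GA R ι where
  toFun := bint l
  map_add' x y := by
    induction l with
    | nil => rfl
    | cons a l ih => simp only [bint, ih, map_add]
  map_smul' c x := by
    induction l with
    | nil => rfl
    | cons a l ih => simp only [bint, ih, map_smul, RingHom.id_apply]

theorem bm_int_zero {ι : Type*} [DecidableEq ι] (l : List ι) (i : ι) (hi : i ∈ l) (x : GA R ι)
    (hx : gaDeriv i x = 0) : bint l x = 0 := by
  have h : ∀ l : List ι, gaDeriv i (bint l x) = 0 := by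
    intro l
    induction l with
    | nil => exact hx
    | cons a l ih => rw [bint, bm_deriv_comm, ih, map_zero, neg_zero]
  induction l with
  | nil => simp at hi
  | cons a l ih =>
    rcases List.mem_cons.1 hi with rfl | hi
    · exact h l
    · rw [bint, ih hi, map_zero]

theorem bm_int_pair {ι : Type*} [DecidableEq ι] (l : List ι) (v w : ι → R)
    (hv : ∀ i ∈ l, v i = 0) (hw : ∀ i ∈ l, w i = 0) (b : GA R ι) :
    bint l (ExteriorAlgebra.ι R v * ExteriorAlgebra.ι R w * b) =
      ExteriorAlgebra.ι R v * ExteriorAlgebra.ι R w * bint l b := by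
  induction l with
  | nil => rfl
  | cons a l ih =>
    rw [bint, ih (fun i hi => hv i (List.mem_cons_of_mem _ hi))
      (fun i hi => hw i (List.mem_cons_of_mem _ hi)),
      bm_deriv_pair _ _ _ (hv a List.mem_cons_self) (hw a List.mem_cons_self), bint]

theorem bm_int_diag {m : ℕ} (l : List (Fin m)) (hl : l.Nodup) :
    bint ((l.map fun i => [Sum.inr i, Sum.inl i]).flatten)
      ((l.map fun i => (psi i * psibar i : GA R (Fin m ⊕ Fin m))).prod) = 1 := by
  induction l with
  | nil => rfl
  | cons a l ih =>
    rw [List.nodup_cons] at hl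
    have e1 : bint ((l.map fun i => [Sum.inr i, Sum.inl i]).flatten)
        (psi a * psibar a * (l.map fun i => (psi i * psibar i : GA R (Fin m ⊕ Fin m))).prod)
        = psi a * psibar a * 1 := by
      rw [← ih hl.2]
      have hne : ∀ i ∈ l, a ≠ i := by rintro i hi rfl; exact hl.1 hi
      apply bm_int_pair <;>
      · intro i hi
        simp only [List.mem_flatten, List.mem_map] at hi
        obtain ⟨_, ⟨b, hb, rfl⟩, hi⟩ := hi
        have := hne b hb
        simp only [List.mem_cons, List.not_mem_nil, or_false] at hi
        rcases hi with rfl | rfl <;> simp [Pi.single_apply, this.symm]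
    rw [List.map_cons, List.map_cons, List.flatten_cons, List.prod_cons]
    rw [List.cons_append, List.cons_append, List.nil_append, bint, bint, e1, mul_assoc, psi, psibar, gaGen, gaGen, bm_deriv, bm_deriv, bm_deriv_one]
    simp only [Pi.single_eq_same, one_smul, mul_zero, sub_zero, mul_one]
    rw [Pi.single_eq_of_ne (by simp)]
    simp only [zero_smul, mul_zero, sub_zero]
    have := bm_deriv (R := R) (Sum.inr a : Fin m ⊕ Fin m) (Pi.single (Sum.inr a) 1) 1
    rw [mul_one, bm_deriv_one] at this
    simpa using this

/-- The element `(Σ v_j ψ_j) ψ̄_i`, linear in `v`. -/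
def bmE (R : Type*) [CommRing R] [Algebra ℚ R] {m : ℕ} (i : Fin m) :
    (Fin m → R) →ₗ[R] bmS R (Fin m ⊕ Fin m) where
  toFun v := ⟨ExteriorAlgebra.ι R (Sum.elim v 0) * psibar i,
    Algebra.subset_adjoin ⟨_, _, rfl⟩⟩
  map_add' v w := by
    apply Subtype.ext
    change _ = ExteriorAlgebra.ι R (Sum.elim v 0) * psibar i + ExteriorAlgebra.ι R (Sum.elim w 0) * psibar i
    rw [← add_mul, ← map_add]
    have h : (Sum.elim (v + w) 0 : Fin m ⊕ Fin m → R) = Sum.elim v 0 + Sum.elim w 0 := by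
      ext x; cases x <;> simp
    rw [← h]
  map_smul' c v := by
    apply Subtype.ext
    change _ = c • (ExteriorAlgebra.ι R (Sum.elim v 0) * psibar i)
    rw [← smul_mul_assoc, ← map_smul]
    have h : (Sum.elim (c • v) 0 : Fin m ⊕ Fin m → R) = c • Sum.elim v 0 := by
      ext x; cases x <;> simp
    rw [← h]

theorem bmE_single {m : ℕ} (i j : Fin m) :
    (bmE R i (Pi.single j 1) : GA R (Fin m ⊕ Fin m)) = psi j * psibar i := by
  change ExteriorAlgebra.ι R _ * _ = ExteriorAlgebra.ι R _ * _
  congr 2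
  ext x; cases x <;> simp [Pi.single_apply]

/-- The integral restricted to the even subalgebra. -/
def bmL (R : Type*) [CommRing R] [Algebra ℚ R] (m : ℕ) : bmS R (Fin m ⊕ Fin m) →ₗ[R] R :=
  (gaCoef (R := R) (ι := Fin m ⊕ Fin m)).toLinearMap ∘ₗ bmInt R (entList m) ∘ₗ
    (bmS R (Fin m ⊕ Fin m)).val.toLinearMap

theorem bmL_apply {m : ℕ} (x : bmS R (Fin m ⊕ Fin m)) :
    bmL R m x = gaCoef (bint (entList m) ((bmS R (Fin m ⊕ Fin m)).val x)) := rfl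

theorem bm_mem_ent {m : ℕ} (k : Fin m) : Sum.inr k ∈ entList m := by
  simp [entList, List.mem_ofFn]

theorem bm_quad {m : ℕ} (A : Matrix (Fin m) (Fin m) R) :
    ((∑ i, bmE R i (A i) : bmS R (Fin m ⊕ Fin m)) : GA R (Fin m ⊕ Fin m)) = -(quadPsi A) := by
  have : ∀ i, (bmE R i (A i) : GA R (Fin m ⊕ Fin m)) = -∑ j, A i j • (psibar i * psi j) := by
    intro i
    have h : A i = ∑ j, A i j • Pi.single j (1:R) := by
      ext k; simp [Finset.sum_apply, Pi.single_apply]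
    conv_lhs => rw [h]
    rw [map_sum, ← Finset.sum_neg_distrib]
    refine (map_sum (bmS R (Fin m ⊕ Fin m)).val _ _).trans ?_
    refine Finset.sum_congr rfl fun j _ => ?_
    rw [map_smul]
    change A i j • (bmE R i (Pi.single j 1) : GA R (Fin m ⊕ Fin m)) = _
    rw [bmE_single, psi, psibar, gaGen, gaGen, bm_anti, smul_neg]
  refine (map_sum (bmS R (Fin m ⊕ Fin m)).val _ _).trans ?_
  rw [quadPsi, ← Finset.sum_neg_distrib]
  exact Finset.sum_congr rfl fun i _ => this i

theorem bm_main (m p : ℕ) (A : Matrix (Fin m) (Fin m) R) (B : Fin m → Fin m → R)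
    (I J : Finset (Fin m)) (hI : I.card = p) (hJ : J.card = p)
    (hB1 : ∀ k, B (I.orderEmbOfFin hI k) = Pi.single (J.orderEmbOfFin hJ k) 1)
    (hB2 : ∀ i, i ∉ I → B i = A i) :
    gaCoef (bint (entList m)
        (((((J.sort (· ≤ ·)).zip (I.sort (· ≤ ·))).map
            (fun x => psi x.1 * psibar x.2)).prod) * gexp (-(quadPsi A)))) =
      Matrix.det (Matrix.of B) := by
  have hsq : ∀ x : Fin m ⊕ Fin m → R, ExteriorAlgebra.ι R x * ExteriorAlgebra.ι R x = 0 :=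
    fun x => ExteriorAlgebra.ι_sq_zero x
  rw [← bm_core (bmE R) (bmL R m) ?h1 ?h2 ?h3 ?h4 (fun i => A i) B I J hI hJ hB1 hB2
    (Fintype.card (Fin m ⊕ Fin m)) (by simp)]
  case h1 =>
    intro i v w
    apply Subtype.ext
    change ExteriorAlgebra.ι R _ * psibar i * (ExteriorAlgebra.ι R _ * psibar i) = 0
    rw [mul_assoc, ← mul_assoc (psibar i), psibar, gaGen, bm_anti (Pi.single _ _), neg_mul,
      mul_assoc, hsq]
    simp
  case h2 =>
    intro i j v
    apply Subtype.ext
    change ExteriorAlgebra.ι R _ * psibar i * (ExteriorAlgebra.ι R _ * psibar j) = 0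
    rw [mul_assoc, ← mul_assoc (psibar i), psibar, gaGen, bm_anti (Pi.single _ _), neg_mul,
      mul_assoc, mul_neg, ← mul_assoc, hsq]
    simp
  case h3 =>
    intro T hT v
    obtain ⟨k, hk⟩ : ∃ k, k ∉ T := by
      by_contra! h; exact hT (Finset.eq_univ_iff_forall.2 h)
    have : gaDeriv (Sum.inr k) ((∏ i ∈ T, bmE R i (v i) : bmS R (Fin m ⊕ Fin m)) :
        GA R (Fin m ⊕ Fin m)) = 0 := by
      clear hT
      induction T using Finset.induction_on with
      | empty => exact bm_deriv_one _
      | insert a T ha ih =>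
        rw [Finset.prod_insert ha]
        rw [Finset.mem_insert, not_or] at hk
        change gaDeriv _ (ExteriorAlgebra.ι R _ * psibar a * (((∏ i ∈ T, bmE R i (v i)) :
          bmS R (Fin m ⊕ Fin m)) : GA R (Fin m ⊕ Fin m))) = 0
        rw [psibar, gaGen, bm_deriv_pair _ _ _ (by simp) (by simp [Pi.single_apply, hk.1]), ih hk.2,
          mul_zero]
    exact (congrArg gaCoef (bm_int_zero _ _ (bm_mem_ent k) _ this)).trans (map_zero _)
  case h4 =>
    rw [Fin.prod_univ_def]
    change gaCoef (bint _ ((bmS R (Fin m ⊕ Fin m)).val _)) = 1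
    have e1 := map_list_prod (bmS R (Fin m ⊕ Fin m)).val
      ((List.finRange m).map fun i => bmE R i (Pi.single i 1))
    have e2 : (bmS R (Fin m ⊕ Fin m)).val
      ((List.finRange m).map fun i => bmE R i (Pi.single i 1)).prod =
      ((List.finRange m).map fun i => (psi i * psibar i : GA R (Fin m ⊕ Fin m))).prod := by
      refine e1.trans ?_
      rw [List.map_map]
      congr 1
      refine List.map_congr_left fun i _ => ?_
      exact bmE_single i i
    have e3 := bm_int_diag (R := R) (List.finRange m) (List.nodup_finRange m)
    rw [← e2, ← List.ofFn_eq_map] at e3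
    refine (congrArg gaCoef e3).trans (map_one _)
  refine Eq.trans ?_ (bmL_apply _).symm
  congr 2
  refine Eq.trans ?_ (map_mul (bmS R (Fin m ⊕ Fin m)).val _ _).symm
  congr 1
  · rw [Fin.prod_univ_def]
    refine Eq.trans ?_ (map_list_prod (bmS R (Fin m ⊕ Fin m)).val _).symm
    rw [← Finset.listMap_orderEmbOfFin_finRange I hI, ← Finset.listMap_orderEmbOfFin_finRange J hJ,
      List.zip_map', List.map_map, List.map_map]
    congr 1
    refine List.map_congr_left fun k _ => ?_
    exact (bmE_single _ _).symm
  · rw [gexp]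
    refine Eq.trans ?_ (map_sum (bmS R (Fin m ⊕ Fin m)).val _ _).symm
    refine Finset.sum_congr rfl fun q _ => ?_
    refine Eq.trans ?_ (map_smul (bmS R (Fin m ⊕ Fin m)).val _ _).symm
    congr 1
    refine Eq.trans ?_ (map_pow (bmS R (Fin m ⊕ Fin m)).val _ _).symm
    congr 1
    exact (bm_quad A).symm

theorem bm_final (m p n : ℕ) (hm : m = p + n) (A : Matrix (Fin m) (Fin m) R)
    (I J : Finset (Fin m)) (hI : I.card = p) (hJ : J.card = p)
    (hIc : Iᶜ.card = n) (hJc : Jᶜ.card = n) :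
    gaCoef (bint (entList m)
        (((((J.sort (· ≤ ·)).zip (I.sort (· ≤ ·))).map
            (fun x => psi x.1 * psibar x.2)).prod) * gexp (-(quadPsi A)))) =
      (-1 : R) ^ ((∑ i ∈ I, ((i : ℕ) + 1)) + ∑ j ∈ J, ((j : ℕ) + 1)) *
        Matrix.det (A.submatrix (Iᶜ.orderEmbOfFin hIc) (Jᶜ.orderEmbOfFin hJc)) := by
  subst hm
  classical
  let B : Fin (p + n) → Fin (p + n) → R := fun i =>
    if h : ∃ k, I.orderEmbOfFin hI k = i then Pi.single (J.orderEmbOfFin hJ h.choose) 1 else A i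
  have hB1 : ∀ k, B (I.orderEmbOfFin hI k) = Pi.single (J.orderEmbOfFin hJ k) 1 := by
    intro k
    have h : ∃ k', I.orderEmbOfFin hI k' = I.orderEmbOfFin hI k := ⟨k, rfl⟩
    have h' := (I.orderEmbOfFin hI).injective h.choose_spec
    simp only [B]
    rw [dif_pos h, h']
  have hB2 : ∀ i, i ∉ I → B i = A i := by
    intro i hi
    simp only [B]
    rw [dif_neg]
    rintro ⟨k, rfl⟩
    exact hi (Finset.orderEmbOfFin_mem _ _ _)
  rw [bm_main _ p A B I J hI hJ hB1 hB2, bm_det A (Matrix.of B) I J hI hIc hJ hJc hB1 hB2]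
  congr 1
  simp only [Finset.sum_add_distrib, Finset.sum_const, hI, hJ, smul_eq_mul, mul_one]
  rw [show ∀ a b : ℕ, a + p + (b + p) = a + b + 2 * p by intros; ring, pow_add _ _ (2 * p), pow_mul]
  simp

/-- All-minors formula: for `p`-element subsets `I, J` of `{1,…,m}` (1-based),
`∫ (dψ̄ dψ)_ent ψ_{j₁}ψ̄_{i₁} ⋯ ψ_{j_p}ψ̄_{i_p} exp(-ψ̄Aψ)
  = (-1)^(ΣI+ΣJ) det (A_{Iᶜ,Jᶜ})`. -/
theorem berezin_minor (m p : ℕ) (A : Matrix (Fin m) (Fin m) R)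
    (I J : Finset (Fin m)) (hI : I.card = p) (hJ : J.card = p) :
    gaCoef (bint (entList m)
        (((((J.sort (· ≤ ·)).zip (I.sort (· ≤ ·))).map
            (fun x => psi x.1 * psibar x.2)).prod) * gexp (-(quadPsi A)))) =
      (-1 : R) ^ ((∑ i ∈ I, ((i : ℕ) + 1)) + ∑ j ∈ J, ((j : ℕ) + 1)) *
        Matrix.det (fun (a b : Fin (m - p)) =>
          A ((Iᶜ.orderIsoOfFin (by simp [Finset.card_compl, hI])) a)
            ((Jᶜ.orderIsoOfFin (by simp [Finset.card_compl, hJ])) b)) := by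
  have hle : p ≤ m := by
    rw [← hI]; exact (Finset.card_le_univ I).trans (by simp)
  exact bm_final m p (m - p) (by omega) A I J hI hJ (by simp [Finset.card_compl, hI])
    (by simp [Finset.card_compl, hJ])
end
end

section
/- Massive all-minors matrix-tree theorem: let A be an n×n matrix over R and I = {i₁ < ⋯ < i_p}, J = {j₁ < ⋯ < j_p} two p-element subsets of {1,…,n}. Then det(A_{I^c,J^c}) = (−1)^{ΣI+ΣJ} Σ_{(F,R) admissible} ε(F) · Π_{j∈R} (Σ_{i=1}^n Aᵢⱼ) · Π_{(i,j)∈F} (−Aᵢⱼ), where the sum is over admissible pairs (F,R) of a directed forest F on vertex set {1,…,n} and a root set R ⊆ {1,…,n}. -/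
set_option synthInstance.maxHeartbeats 1000000
set_option maxHeartbeats 1000000

noncomputable section

variable {R : Type*} [CommRing R] [Algebra ℚ R]

open scoped Classical

/-- The undirected simple graph underlying a set `F` of directed edges on `{1,…,n}`. -/
def forestGraph {n : ℕ} (F : Finset (Fin n × Fin n)) : SimpleGraph (Fin n) :=
  SimpleGraph.fromRel (fun u v => (u, v) ∈ F)

/-- `F` is a directed forest: no loops, no edge together with its reverse, and the
underlying undirected graph is acyclic. -/
def IsDirForest {n : ℕ} (F : Finset (Fin n × Fin n)) : Prop :=
  (∀ e ∈ F, e.1 ≠ e.2) ∧ (∀ e ∈ F, (e.2, e.1) ∉ F) ∧ (forestGraph F).IsAcyclic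

/-- All edges of `F` lying in the connected component of `r` are oriented away from `r`. -/
def OrientedAway {n : ℕ} (F : Finset (Fin n × Fin n)) (r : Fin n) : Prop :=
  ∀ e ∈ F, (forestGraph F).Reachable r e.1 →
    (forestGraph F).dist r e.2 = (forestGraph F).dist r e.1 + 1

/-- `F` is an admissible directed forest with respect to the index sets `I` and `J`. -/
def AdmissibleForest {n : ℕ} (I J : Finset (Fin n)) (F : Finset (Fin n × Fin n)) : Prop :=
  IsDirForest F ∧
    (∀ v : Fin n, (∃ u ∈ I ∪ J, (forestGraph F).Reachable v u) →
      ((∃! u, u ∈ I ∧ (forestGraph F).Reachable v u) ∧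
        (∃! u, u ∈ J ∧ (forestGraph F).Reachable v u))) ∧
    (∀ j ∈ J, OrientedAway F j)

/-- The pair `(F, Rt)` of a directed forest and a set of roots is admissible with
respect to `I` and `J`. -/
def AdmissiblePair {n : ℕ} (I J : Finset (Fin n)) (F : Finset (Fin n × Fin n))
    (Rt : Finset (Fin n)) : Prop :=
  AdmissibleForest I J F ∧
    (∀ v : Fin n, (¬ ∃ u ∈ I ∪ J, (forestGraph F).Reachable v u) →
      ∃! r, r ∈ Rt ∧ (forestGraph F).Reachable v r) ∧
    (∀ r ∈ Rt, ¬ ∃ u ∈ I ∪ J, (forestGraph F).Reachable r u) ∧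
    (∀ r ∈ Rt, OrientedAway F r)

/-- `σ` is the permutation matching `j_α` with `i_{σ(α)}` through the components of `F`;
its sign is the signature `ε(F)` of the admissible forest `F`. -/
def MatchPerm {n p : ℕ} (I J : Finset (Fin n)) (hI : I.card = p) (hJ : J.card = p)
    (F : Finset (Fin n × Fin n)) (σ : Equiv.Perm (Fin p)) : Prop :=
  ∀ α : Fin p, (forestGraph F).Reachable
    ((J.orderIsoOfFin hJ α) : Fin n) ((I.orderIsoOfFin hI (σ α)) : Fin n)


abbrev Anc {n : ℕ} (g : Fin n → Option (Fin n)) : Fin n → Fin n → Prop :=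
  Relation.ReflTransGen (fun a b => g a = some b)

def Acyc {n : ℕ} (g : Fin n → Option (Fin n)) : Prop :=
  ∃ h : Fin n → ℕ, (∀ j i, g j = some i → h j = h i + 1) ∧ ∀ j, g j = none → h j = 0

lemma acyc_of_no_cycle {n : ℕ} (g : Fin n → Option (Fin n))
    (hg : ∀ j, ¬ Relation.TransGen (fun a b => g a = some b) j j) : Acyc g := by
  refine ⟨fun j => (Finset.univ.filter
    (fun k => Relation.TransGen (fun a b => g a = some b) j k)).card, ?_, ?_⟩
  · intro j i hij
    have : (Finset.univ.filter (fun k => Relation.TransGen (fun a b => g a = some b) j k)) =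
        insert i (Finset.univ.filter
          (fun k => Relation.TransGen (fun a b => g a = some b) i k)) := by
      ext k
      simp only [Finset.mem_filter, Finset.mem_univ, true_and, Finset.mem_insert]
      constructor
      · intro h
        rw [Relation.TransGen.head'_iff] at h
        obtain ⟨c, hc, hck⟩ := h
        have : c = i := by rw [hij] at hc; exact (Option.some.inj hc).symm
        subst this
        rw [Relation.reflTransGen_iff_eq_or_transGen] at hck
        exact hck
      · rintro (rfl | h)
        · exact Relation.TransGen.single hij
        · exact Relation.TransGen.head hij h
    simp only [this]
    rw [Finset.card_insert_of_notMem]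
    simpa using hg i
  · intro j hj
    rw [Finset.card_eq_zero, Finset.filter_eq_empty_iff]
    intro k _ h
    rw [Relation.TransGen.head'_iff] at h
    obtain ⟨c, hc, _⟩ := h
    rw [hj] at hc; cases hc

lemma anc_le {n : ℕ} {g : Fin n → Option (Fin n)} {h : Fin n → ℕ}
    (hh : ∀ j i, g j = some i → h j = h i + 1) {a b : Fin n} (hab : Anc g a b) :
    h b ≤ h a ∧ (h a ≤ h b → a = b) := by
  induction hab with
  | refl => simp
  | tail _ hbc ih =>
    have := hh _ _ hbc
    constructor
    · omega
    · intro h1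
      omega

lemma anc_none {n : ℕ} {g : Fin n → Option (Fin n)} {a b : Fin n} (hg : g a = none)
    (hab : Anc g a b) : b = a := by
  rcases Relation.ReflTransGen.cases_head hab with h | ⟨c, hc, _⟩
  · exact h.symm
  · rw [hg] at hc; cases hc

lemma anc_some {n : ℕ} {g : Fin n → Option (Fin n)} {a b c : Fin n} (hg : g a = some c) :
    Anc g a b ↔ a = b ∨ Anc g c b := by
  constructor
  · intro hab
    rcases Relation.ReflTransGen.cases_head hab with h | ⟨c', hc, h⟩
    · exact Or.inl h
    · rw [hg] at hc; cases hc; exact Or.inr h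
  · rintro (rfl | h)
    · exact Relation.ReflTransGen.refl
    · exact Relation.ReflTransGen.head hg h

/-- column vectors -/
def colB {K : Type*} [CommRing K] {n : ℕ} (J : Finset (Fin n)) (τ : Equiv.Perm (Fin n))
    (j : Fin n) (o : Option (Fin n)) : Fin n → K :=
  match o with
  | none => if j ∈ J then Pi.single (τ j) 1 else Pi.single j 1
  | some i => Pi.single j 1 - Pi.single i 1

def matB {K : Type*} [CommRing K] {n : ℕ} (J : Finset (Fin n)) (τ : Equiv.Perm (Fin n))
    (g : Fin n → Option (Fin n)) : Matrix (Fin n) (Fin n) K :=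
  Matrix.of fun k j => colB J τ j (g j) k

lemma det_cyclic {K : Type*} [CommRing K] {n : ℕ} (J : Finset (Fin n)) (τ : Equiv.Perm (Fin n))
    (g : Fin n → Option (Fin n)) (hg : ¬ Acyc g) :
    (matB J τ g : Matrix (Fin n) (Fin n) K).det = 0 := by
  have : ∃ j, Relation.TransGen (fun a b => g a = some b) j j := by
    by_contra hcon
    push Not at hcon
    exact hg (acyc_of_no_cycle g hcon)
  obtain ⟨j0, hj0⟩ := this
  set S : Finset (Fin n) := Finset.univ.filter
    (fun j => Relation.TransGen (fun a b => g a = some b) j j) with hS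
  have hmem : ∀ j ∈ S, ∃ i ∈ S, g j = some i := by
    intro j hj
    have hj' : Relation.TransGen (fun a b => g a = some b) j j := by simpa [hS] using hj
    obtain ⟨c, hc, hcj⟩ := Relation.TransGen.head'_iff.1 hj'
    refine ⟨c, ?_, hc⟩
    simp only [hS, Finset.mem_filter, Finset.mem_univ, true_and]
    exact Relation.TransGen.tail' hcj hc
  have hsurj : ∀ j ∈ S, ∃ i ∈ S, g i = some j := by
    intro j hj
    have hj' : Relation.TransGen (fun a b => g a = some b) j j := by simpa [hS] using hj
    obtain ⟨c, hc, hcj⟩ := Relation.TransGen.tail'_iff.1 hj'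
    refine ⟨c, ?_, hcj⟩
    simp only [hS, Finset.mem_filter, Finset.mem_univ, true_and]
    exact Relation.TransGen.head' hcj hc
  let f : Fin n → Fin n := fun j => (g j).getD j
  have hf : ∀ j ∈ S, g j = some (f j) ∧ f j ∈ S := by
    intro j hj
    obtain ⟨i, hi, h⟩ := hmem j hj
    simp [f, h, hi]
  have hsurjOn : Set.SurjOn f S S := by
    intro j hj
    obtain ⟨i, hi, h⟩ := hsurj j hj
    exact ⟨i, hi, by simp [f, h]⟩
  have hinj : Set.InjOn f S := Finset.injOn_of_surjOn_of_card_le f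
    (fun j hj => (hf j hj).2) hsurjOn le_rfl
  let v : Fin n → K := fun j => if j ∈ S then 1 else 0
  have hv : (matB J τ g : Matrix (Fin n) (Fin n) K).mulVec v = 0 := by
    have h1 : ∑ j ∈ S, (Pi.single (f j) 1 : Fin n → K) = ∑ j ∈ S, Pi.single j 1 :=
      Finset.sum_nbij f (fun j hj => (hf j hj).2) hinj hsurjOn (fun _ _ => rfl)
    have h2 : ∑ j ∈ S, colB (K := K) J τ j (g j) = 0 := by
      rw [Finset.sum_congr rfl (g := fun j => Pi.single j 1 - Pi.single (f j) 1)]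
      · rw [Finset.sum_sub_distrib, h1, sub_self]
      · intro j hj
        rw [(hf j hj).1]; rfl
    ext k
    have h3 := congrFun h2 k
    rw [Finset.sum_apply] at h3
    simp only [Matrix.mulVec, dotProduct, matB, Matrix.of_apply, v, mul_ite, mul_one, mul_zero]
    rw [← Finset.sum_filter]
    simpa using h3
  have h4 : (matB J τ g : Matrix (Fin n) (Fin n) K).det • v = 0 := by
    have := congrArg (fun u => (matB J τ g : Matrix (Fin n) (Fin n) K).adjugate.mulVec u) hv
    simpa [Matrix.mulVec_mulVec, Matrix.adjugate_mul, Matrix.smul_mulVec] using this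
  have h5 := congrFun h4 j0
  simpa [v, hS, hj0] using h5

lemma det_acyclic {K : Type*} [CommRing K] {n p q : ℕ} (J I : Finset (Fin n))
    (hI : I.card = p) (hJ : J.card = p) (hI' : Iᶜ.card = q) (hJ' : Jᶜ.card = q)
    (g : Fin n → Option (Fin n)) (hg : Acyc g) (hgJ : ∀ j ∈ J, g j = none) :
    (matB J ((finSumEquivOfFinset hJ hJ').symm.trans (finSumEquivOfFinset hI hI')) g :
      Matrix (Fin n) (Fin n) K).det =
    ∑ σ : Equiv.Perm (Fin p), ((Equiv.Perm.sign σ : ℤ) : K) *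
      if (∀ α, Anc g (I.orderEmbOfFin hI (σ α)) (J.orderEmbOfFin hJ α)) then 1 else 0 := by
  obtain ⟨h, hh, h0⟩ := hg
  set τ := (finSumEquivOfFinset hJ hJ').symm.trans (finSumEquivOfFinset hI hI') with hτ
  let T : Matrix (Fin n) (Fin n) K := Matrix.of fun k j => if Anc g j k then 1 else 0
  have hT : T.det = 1 := by
    have hb : T.BlockTriangular h := by
      intro i j hij
      simp only [T, Matrix.of_apply, ite_eq_right_iff]
      intro ha
      have := (anc_le hh ha).1
      omega
    rw [hb.det]
    apply Finset.prod_eq_one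
    intro a _
    have : T.toSquareBlock h a = 1 := by
      ext ⟨i, hi⟩ ⟨j, hj⟩
      simp only [Matrix.toSquareBlock_def, Matrix.of_apply, T, Matrix.one_apply, Subtype.mk.injEq]
      congr 1
      apply propext
      constructor
      · intro ha
        exact ((anc_le hh ha).2 (by rw [hi, hj])).symm
      · rintro rfl
        exact Relation.ReflTransGen.refl
    rw [this, Matrix.det_one]
  have hQ : ∀ k j, (T * (matB J τ g : Matrix (Fin n) (Fin n) K)) k j =
      if j ∈ J then T k (τ j) else if k = j then 1 else 0 := by
    intro k j
    have e1 : (T * (matB J τ g : Matrix (Fin n) (Fin n) K)) k j = T.mulVec (colB J τ j (g j)) k := by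
      simp [Matrix.mul_apply, Matrix.mulVec, dotProduct, matB]
    rw [e1]
    by_cases hj : j ∈ J
    · simp [hgJ j hj, colB, hj]
    · rw [if_neg hj]
      rcases hgj : g j with _ | i
      · simp only [colB, hj, if_false, Matrix.mulVec_single_one]
        simp only [T, Matrix.col_apply, Matrix.of_apply]
        congr 1
        apply propext
        constructor
        · exact fun ha => anc_none hgj ha
        · rintro rfl
          exact Relation.ReflTransGen.refl
      · simp only [colB, Matrix.mulVec_sub, Matrix.mulVec_single_one, Pi.sub_apply]
        simp only [T, Matrix.col_apply, Matrix.of_apply]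
        have hij := hh _ _ hgj
        by_cases hkj : k = j
        · subst hkj
          have : ¬ Anc g i k := fun ha => by have := (anc_le hh ha).1; omega
          rw [if_pos Relation.ReflTransGen.refl, if_neg this]; simp
        · have : Anc g j k ↔ Anc g i k := by
            rw [anc_some hgj]
            constructor
            · rintro (h | h)
              · exact absurd h.symm hkj
              · exact h
            · exact Or.inr
          simp [this, hkj]
  have hdet : (matB J τ g : Matrix (Fin n) (Fin n) K).det = (T * matB J τ g).det := by
    rw [Matrix.det_mul, hT, one_mul]
  rw [hdet, ← Matrix.det_submatrix_equiv_self (finSumEquivOfFinset hJ hJ')]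
  have hblock : (T * matB J τ g).submatrix (finSumEquivOfFinset hJ hJ') (finSumEquivOfFinset hJ hJ')
      = Matrix.fromBlocks
        (Matrix.of fun a b => T (J.orderEmbOfFin hJ a) (I.orderEmbOfFin hI b)) 0
        (Matrix.of fun a b => T (Jᶜ.orderEmbOfFin hJ' a) (I.orderEmbOfFin hI b)) 1 := by
    have m1 : ∀ b, J.orderEmbOfFin hJ b ∈ J := fun b => Finset.orderEmbOfFin_mem J hJ b
    have m2 : ∀ b, Jᶜ.orderEmbOfFin hJ' b ∉ J := fun b => by
      exact Finset.mem_compl.1 (Finset.orderEmbOfFin_mem Jᶜ hJ' b)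
    have t1 : ∀ b, τ (J.orderEmbOfFin hJ b) = I.orderEmbOfFin hI b := fun b => by
      rw [hτ, ← finSumEquivOfFinset_inl hJ hJ', Equiv.trans_apply, Equiv.symm_apply_apply,
        finSumEquivOfFinset_inl]
    ext (a | a) (b | b)
    · simp [hQ, m1, t1]
    · simp only [Matrix.submatrix_apply, hQ, finSumEquivOfFinset_inl, finSumEquivOfFinset_inr, m2]
      have : J.orderEmbOfFin hJ a ≠ Jᶜ.orderEmbOfFin hJ' b := fun h => m2 b (h ▸ m1 a)
      simp [this]
    · simp [hQ, m1, t1]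
    · simp [hQ, m2, Matrix.one_apply]
  rw [hblock, Matrix.det_fromBlocks_zero₁₂, Matrix.det_one, mul_one, ← Matrix.det_transpose,
    Matrix.det_apply']
  refine Finset.sum_congr rfl fun σ _ => ?_
  congr 1
  simp only [Matrix.transpose_apply, Matrix.of_apply, T, Finset.prod_boole, Finset.mem_univ,
    true_imp_iff]

lemma shuffle_sign {n p q : ℕ} (hn : p + q = n) (I : Finset (Fin n))
    (hI : I.card = p) (hI' : Iᶜ.card = q) :
    Equiv.Perm.sign ((finSumFinEquiv.trans (finCongr hn)).symm.trans (finSumEquivOfFinset hI hI'))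
      * ∏ a : Fin p, ∏ a' : Fin p, (if a ≤ a' then (1 : ℤˣ) else -1)
      = (-1) ^ (∑ i ∈ I, (i : ℕ)) := by
  subst hn
  set e := finSumEquivOfFinset hI hI' with he
  have hmono1 : ∀ a b : Fin p, e (Sum.inl a) < e (Sum.inl b) ↔ a < b := fun a b => by
    simp [he]
  have hmono2 : ∀ a b : Fin q, e (Sum.inr a) < e (Sum.inr b) ↔ a < b := fun a b => by
    simp [he]
  have h1 : Equiv.Perm.sign ((finSumFinEquiv.trans (finCongr rfl)).symm.trans e) =
      ∏ b : Fin q, ∏ a : Fin p, if e (Sum.inl a) < e (Sum.inr b) then (1 : ℤˣ) else -1 := by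
    rw [Equiv.Perm.sign_eq_prod_prod_Iio]
    simp only [← Finset.filter_gt_eq_Iio, Finset.prod_filter, Fin.prod_univ_add]
    simp only [Equiv.trans_apply, Equiv.symm_trans_apply, finCongr_symm, finCongr_apply,
      Fin.cast_refl, id_eq, finSumFinEquiv_symm_apply_castAdd, finSumFinEquiv_symm_apply_natAdd,
      hmono1, hmono2]
    have c1 : ∀ (a b : Fin p), (if Fin.castAdd q b < Fin.castAdd q a then
        if b < a then (1 : ℤˣ) else -1 else 1) = 1 := by
      intro a b
      by_cases h : b < a <;> simp [h, Fin.lt_def]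
    have c2 : ∀ (a b : Fin q), (if Fin.natAdd p b < Fin.natAdd p a then
        if b < a then (1 : ℤˣ) else -1 else 1) = 1 := by
      intro a b
      by_cases h : b < a <;> simp [h]
    have c3 : ∀ (a : Fin p) (b : Fin q), Fin.castAdd q a < Fin.natAdd p b := by
      intro a b
      simp [Fin.lt_def]; omega
    have c4 : ∀ (a : Fin p) (b : Fin q), ¬ Fin.natAdd p b < Fin.castAdd q a := by
      intro a b
      simp [Fin.lt_def]; omega
    simp only [c1, c2, c3, c4, if_true, if_false, Finset.prod_const_one, mul_one, one_mul]
  have h2 : ∀ a : Fin p, (∏ b : Fin q, if e (Sum.inl a) < e (Sum.inr b) then (1 : ℤˣ) else -1) *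
      (∏ a' : Fin p, (if a ≤ a' then (1 : ℤˣ) else -1)) = (-1) ^ ((e (Sum.inl a) : Fin _) : ℕ) := by
    intro a
    have e1 : ∏ k : Fin (p + q), (if e (Sum.inl a) ≤ k then (1 : ℤˣ) else -1) =
        (-1) ^ ((e (Sum.inl a) : Fin _) : ℕ) := by
      have : ∀ k, (if e (Sum.inl a) ≤ k then (1 : ℤˣ) else -1) =
          if k < e (Sum.inl a) then -1 else 1 := by
        intro k
        by_cases h : k < e (Sum.inl a)
        · simp [h, not_le.2 h]
        · simp [h, not_lt.1 h]
      simp only [this]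
      rw [← Finset.prod_filter, Finset.filter_gt_eq_Iio, Finset.prod_const, Fin.card_Iio]
    rw [← e1, ← Equiv.prod_comp e, Fintype.prod_sum_type, mul_comm]
    congr 1
    · refine Finset.prod_congr rfl fun b _ => ?_
      have : e (Sum.inl a) ≤ e (Sum.inl b) ↔ a ≤ b := by
        rw [← not_lt, hmono1, not_lt]
      simp only [this]
    · refine Finset.prod_congr rfl fun b _ => ?_
      have : e (Sum.inl a) ≤ e (Sum.inr b) ↔ e (Sum.inl a) < e (Sum.inr b) :=
        ⟨fun h => lt_of_le_of_ne h (fun h => by simpa using e.injective h), le_of_lt⟩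
      simp only [this]
  rw [h1, Finset.prod_comm, ← Finset.prod_mul_distrib]
  simp only [h2]
  rw [Finset.prod_pow_eq_pow_sum]
  congr 1
  rw [← Finset.sum_coe_sort I, ← Equiv.sum_comp (I.orderIsoOfFin hI).toEquiv]
  rfl

lemma shuffle_sign_two {n p q : ℕ} (I J : Finset (Fin n))
    (hI : I.card = p) (hJ : J.card = p) (hI' : Iᶜ.card = q) (hJ' : Jᶜ.card = q) :
    Equiv.Perm.sign ((finSumEquivOfFinset hJ hJ').symm.trans (finSumEquivOfFinset hI hI'))
      = (-1) ^ ((∑ i ∈ I, ((i : ℕ) + 1)) + ∑ j ∈ J, ((j : ℕ) + 1)) := by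
  have hn : p + q = n := by
    have := Finset.card_add_card_compl I
    simpa [hI, hI'] using this
  have a1 := shuffle_sign hn I hI hI'
  have a2 := shuffle_sign hn J hJ hJ'
  set c : ℤˣ := ∏ a : Fin p, ∏ a' : Fin p, (if a ≤ a' then (1 : ℤˣ) else -1)
  have hc : c * c = 1 := Int.units_mul_self c
  have key : (finSumEquivOfFinset hJ hJ').symm.trans (finSumEquivOfFinset hI hI') =
    (((finSumFinEquiv.trans (finCongr hn)).symm.trans (finSumEquivOfFinset hJ hJ')).symm).trans
     ((finSumFinEquiv.trans (finCongr hn)).symm.trans (finSumEquivOfFinset hI hI')) := by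
    ext x; simp
  rw [key, Equiv.Perm.sign_trans, Equiv.Perm.sign_symm]
  simp only [Finset.sum_add_distrib, Finset.sum_const, hI, hJ, smul_eq_mul, mul_one]
  rw [pow_add, pow_add, pow_add, ← a1, ← a2]
  have hp : ((-1 : ℤˣ) ^ p) * (-1) ^ p = 1 := Int.units_mul_self _
  generalize Equiv.Perm.sign ((finSumFinEquiv.trans (finCongr hn)).symm.trans
    (finSumEquivOfFinset hI hI')) = x
  generalize Equiv.Perm.sign ((finSumFinEquiv.trans (finCongr hn)).symm.trans
    (finSumEquivOfFinset hJ hJ')) = y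
  calc x * y = x * y * (c * c) * ((-1) ^ p * (-1) ^ p) := by rw [hc, hp, mul_one, mul_one]
    _ = _ := by ac_rfl

lemma minor_eq {K : Type*} [CommRing K] {n p q : ℕ} (A : Matrix (Fin n) (Fin n) K)
    (I J : Finset (Fin n))
    (hI : I.card = p) (hJ : J.card = p) (hI' : Iᶜ.card = q) (hJ' : Jᶜ.card = q) :
    Matrix.det (fun (a b : Fin q) => A (Iᶜ.orderEmbOfFin hI' a) (Jᶜ.orderEmbOfFin hJ' b)) =
    (-1 : K) ^ ((∑ i ∈ I, ((i : ℕ) + 1)) + ∑ j ∈ J, ((j : ℕ) + 1)) *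
    Matrix.det (Matrix.of fun k j => if j ∈ J then (Pi.single
      ((finSumEquivOfFinset hJ hJ').symm.trans (finSumEquivOfFinset hI hI') j) 1 : Fin n → K) k
      else A k j) := by
  set τ := (finSumEquivOfFinset hJ hJ').symm.trans (finSumEquivOfFinset hI hI') with hτ
  set M : Matrix (Fin n) (Fin n) K := Matrix.of fun k j => if j ∈ J then (Pi.single
      (τ j) 1 : Fin n → K) k else A k j with hM
  have hs := shuffle_sign_two I J hI hJ hI' hJ'
  rw [← hτ] at hs
  have h1 := Matrix.det_permute τ M
  rw [hs] at h1
  have h2 : (M.submatrix τ id).det = Matrix.det (fun (a b : Fin q) =>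
      A (Iᶜ.orderEmbOfFin hI' a) (Jᶜ.orderEmbOfFin hJ' b)) := by
    rw [← Matrix.det_submatrix_equiv_self (finSumEquivOfFinset hJ hJ')]
    have m1 : ∀ b, J.orderEmbOfFin hJ b ∈ J := fun b => Finset.orderEmbOfFin_mem J hJ b
    have m2 : ∀ b, Jᶜ.orderEmbOfFin hJ' b ∉ J := fun b => by
      exact Finset.mem_compl.1 (Finset.orderEmbOfFin_mem Jᶜ hJ' b)
    have t1 : ∀ b, τ (J.orderEmbOfFin hJ b) = I.orderEmbOfFin hI b := fun b => by
      rw [hτ, ← finSumEquivOfFinset_inl hJ hJ', Equiv.trans_apply, Equiv.symm_apply_apply,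
        finSumEquivOfFinset_inl]
    have t2 : ∀ b, τ (Jᶜ.orderEmbOfFin hJ' b) = Iᶜ.orderEmbOfFin hI' b := fun b => by
      rw [hτ, ← finSumEquivOfFinset_inr hJ hJ', Equiv.trans_apply, Equiv.symm_apply_apply,
        finSumEquivOfFinset_inr]
    have hb : (M.submatrix τ id).submatrix (finSumEquivOfFinset hJ hJ') (finSumEquivOfFinset hJ hJ')
      = Matrix.fromBlocks 1
        (Matrix.of fun a b => A (I.orderEmbOfFin hI a) (Jᶜ.orderEmbOfFin hJ' b))
        0 (Matrix.of fun a b => A (Iᶜ.orderEmbOfFin hI' a) (Jᶜ.orderEmbOfFin hJ' b)) := by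
      ext (a | a) (b | b)
      · simp [hM, m1, t1, Pi.single_apply, Matrix.one_apply]
      · simp [hM, m2, t1]
      · have : Iᶜ.orderEmbOfFin hI' a ≠ I.orderEmbOfFin hI b := fun h =>
          Finset.mem_compl.1 (Finset.orderEmbOfFin_mem Iᶜ hI' a)
            (h ▸ Finset.orderEmbOfFin_mem I hI b)
        simp [hM, m1, t1, t2, Pi.single_apply, this]
      · simp [hM, m2, t2]
    rw [hb, Matrix.det_fromBlocks_zero₂₁, Matrix.det_one, one_mul]
    rfl
  rw [← h2, h1]
  push_cast
  rfl

def Fg {n : ℕ} (g : Fin n → Option (Fin n)) : Finset (Fin n × Fin n) :=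
  Finset.univ.filter (fun e => g e.2 = some e.1)

def Rg {n : ℕ} (J : Finset (Fin n)) (g : Fin n → Option (Fin n)) : Finset (Fin n) :=
  Finset.univ.filter (fun j => j ∉ J ∧ g j = none)

lemma mem_Fg {n : ℕ} {g : Fin n → Option (Fin n)} {u v : Fin n} :
    (u, v) ∈ Fg g ↔ g v = some u := by simp [Fg]

lemma forest_adj {n : ℕ} {F : Finset (Fin n × Fin n)} {u v : Fin n} :
    (forestGraph F).Adj u v ↔ u ≠ v ∧ ((u, v) ∈ F ∨ (v, u) ∈ F) := by
  simp [forestGraph, SimpleGraph.fromRel_adj]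

lemma reach_closed {V : Type*} {G : SimpleGraph V} (P : V → Prop)
    (hP : ∀ x y, G.Adj x y → P x → P y) {u v : V} (h : G.Reachable u v) (hu : P u) : P v := by
  obtain ⟨w⟩ := h
  induction w with
  | nil => exact hu
  | cons hadj _ ih => exact ih (hP _ _ hadj hu)

lemma exists_root {n : ℕ} {g : Fin n → Option (Fin n)} (hg : Acyc g) :
    ∃ ρ : Fin n → Fin n, (∀ v, Anc g v (ρ v)) ∧ (∀ v, g (ρ v) = none) ∧
      (∀ v u, g v = some u → ρ v = ρ u) ∧ (∀ v, g v = none → ρ v = v) ∧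
      (∀ v r, Anc g v r → g r = none → ρ v = r) := by
  obtain ⟨h, hh, h0⟩ := hg
  have ex : ∀ k v, h v = k → ∃ r, Anc g v r ∧ g r = none := by
    intro k
    induction k with
    | zero =>
      intro v hv
      rcases hgv : g v with _ | u
      · exact ⟨v, Relation.ReflTransGen.refl, hgv⟩
      · have := hh _ _ hgv; omega
    | succ k ih =>
      intro v hv
      rcases hgv : g v with _ | u
      · exact ⟨v, Relation.ReflTransGen.refl, hgv⟩
      · have := hh _ _ hgv
        obtain ⟨r, h1, h2⟩ := ih u (by omega)
        exact ⟨r, Relation.ReflTransGen.head hgv h1, h2⟩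
  have un : ∀ v r r', Anc g v r → g r = none → Anc g v r' → g r' = none → r = r' := by
    intro v r r' h1 h2 h3 h4
    induction h1 using Relation.ReflTransGen.head_induction_on with
    | refl => exact (anc_none h2 h3).symm
    | head hac _ ih =>
      rcases (anc_some hac).1 h3 with h | h
      · subst h; rw [h4] at hac; cases hac
      · exact ih h
  choose ρ h1 h2 using fun v => ex _ v rfl
  have un' : ∀ v r, Anc g v r → g r = none → ρ v = r := fun v r a b =>
    un v _ _ (h1 v) (h2 v) a b
  refine ⟨ρ, h1, h2, ?_, ?_, un'⟩
  · intro v u hvu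
    exact un' _ _ (Relation.ReflTransGen.head hvu (h1 u)) (h2 u)
  · intro v hv
    exact un' _ _ Relation.ReflTransGen.refl hv

lemma anc_reach {n : ℕ} {g : Fin n → Option (Fin n)} (hg : Acyc g) {a b : Fin n}
    (hab : Anc g a b) : (forestGraph (Fg g)).Reachable a b := by
  obtain ⟨h, hh, h0⟩ := hg
  induction hab with
  | refl => exact SimpleGraph.Reachable.refl _
  | @tail b c _ hbc ih =>
    refine ih.trans (SimpleGraph.Adj.reachable ?_)
    rw [forest_adj]
    refine ⟨?_, Or.inr (mem_Fg.2 hbc)⟩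
    rintro rfl
    have := hh _ _ hbc; omega

lemma acyclic_Fg {n : ℕ} {g : Fin n → Option (Fin n)} (hg : Acyc g) :
    (forestGraph (Fg g)).IsAcyclic := by
  obtain ⟨h, hh, h0⟩ := hg
  rw [SimpleGraph.isAcyclic_iff_forall_adj_isBridge]
  have key : ∀ u v, g v = some u → (forestGraph (Fg g)).IsBridge s(v, u) := by
    intro u v hvu
    rw [SimpleGraph.isBridge_iff]
    intro hr
    have hD := reach_closed (fun x => Anc g x v) ?_ hr Relation.ReflTransGen.refl
    · have := (anc_le hh hD).1
      have := hh _ _ hvu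
      omega
    · intro x y hxy hx
      rw [SimpleGraph.deleteEdges_adj, forest_adj, mem_Fg, mem_Fg] at hxy
      obtain ⟨⟨_, h1 | h1⟩, h2⟩ := hxy
      · exact Relation.ReflTransGen.head h1 hx
      · rcases (anc_some h1).1 hx with h3 | h3
        · subst h3
          rw [hvu] at h1; cases h1
          simp at h2
        · exact h3
  intro u v huv
  rw [forest_adj, mem_Fg, mem_Fg] at huv
  rcases huv.2 with h1 | h1
  · rw [Sym2.eq_swap]; exact key _ _ h1
  · exact key _ _ h1

lemma oriented_Fg {n : ℕ} {g : Fin n → Option (Fin n)} (hg : Acyc g) {r : Fin n}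
    (hr : g r = none) : OrientedAway (Fg g) r := by
  obtain ⟨ρ, _, hρ2, hρ3, hρ4, _⟩ := exists_root hg
  obtain ⟨h, hh, h0⟩ := hg
  have up : ∀ k v, h v = k → ∃ w : (forestGraph (Fg g)).Walk (ρ v) v, w.length = k := by
    intro k
    induction k with
    | zero =>
      intro v hv
      rcases hgv : g v with _ | u
      · rw [hρ4 v hgv]
        exact ⟨SimpleGraph.Walk.nil, rfl⟩
      · have := hh _ _ hgv; omega
    | succ k ih =>
      intro v hv
      rcases hgv : g v with _ | u
      · have := h0 _ hgv; omega
      · have hv' := hh _ _ hgv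
        obtain ⟨w, hw⟩ := ih u (by omega)
        rw [hρ3 _ _ hgv]
        have hadj : (forestGraph (Fg g)).Adj u v := by
          rw [forest_adj]
          refine ⟨?_, Or.inl (mem_Fg.2 hgv)⟩
          rintro rfl
          omega
        exact ⟨w.concat hadj, by rw [SimpleGraph.Walk.length_concat, hw]⟩
  have low : ∀ u v (w : (forestGraph (Fg g)).Walk u v), h v ≤ h u + w.length := by
    intro u v w
    induction w with
    | nil => simp
    | cons hadj _ ih =>
      rw [forest_adj, mem_Fg, mem_Fg] at hadj
      rw [SimpleGraph.Walk.length_cons]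
      rcases hadj.2 with h1 | h1
      · have := hh _ _ h1; omega
      · have := hh _ _ h1; omega
  have hd : ∀ v, (forestGraph (Fg g)).dist (ρ v) v = h v := by
    intro v
    obtain ⟨w, hw⟩ := up _ v rfl
    apply le_antisymm
    · rw [← hw]; exact SimpleGraph.dist_le w
    · obtain ⟨w', hw'⟩ := w.reachable.exists_walk_length_eq_dist
      have := low _ _ w'
      rw [h0 _ (hρ2 v)] at this
      omega
  intro e he hre
  obtain ⟨u, v⟩ := e
  have he' := mem_Fg.1 he
  have hru : ρ u = r := by
    have := reach_closed (fun x => ρ x = ρ r) ?_ hre rfl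
    · simpa [hρ4 r hr] using this
    · intro x y hxy hx
      rw [forest_adj, mem_Fg, mem_Fg] at hxy
      rcases hxy.2 with h1 | h1
      · rw [hρ3 _ _ h1, hx]
      · rw [← hρ3 _ _ h1, hx]
  have h1 := hd v
  have h2 := hd u
  rw [hρ3 _ _ he'] at h1
  rw [hru] at h1 h2
  simp only [h1, h2]
  exact hh _ _ he'

lemma good_admissible {n p : ℕ} (I J : Finset (Fin n)) (hI : I.card = p) (hJ : J.card = p)
    (σ : Equiv.Perm (Fin p)) (g : Fin n → Option (Fin n)) (hg : Acyc g)
    (hgJ : ∀ j ∈ J, g j = none)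
    (hσ : ∀ α, Anc g (I.orderEmbOfFin hI (σ α)) (J.orderEmbOfFin hJ α)) :
    AdmissiblePair I J (Fg g) (Rg J g) ∧ MatchPerm I J hI hJ (Fg g) σ := by
  obtain ⟨ρ, hρ1, hρ2, hρ3, hρ4, hρ5⟩ := exists_root hg
  have hreach : ∀ u v, (forestGraph (Fg g)).Reachable u v ↔ ρ u = ρ v := by
    intro u v
    constructor
    · intro h
      refine (reach_closed (fun x => ρ x = ρ u) ?_ h rfl).symm
      intro x y hxy hx
      rw [forest_adj, mem_Fg, mem_Fg] at hxy
      rcases hxy.2 with h1 | h1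
      · rw [hρ3 _ _ h1, hx]
      · rw [← hρ3 _ _ h1, hx]
    · intro h
      have h1 := anc_reach hg (hρ1 u)
      rw [h] at h1
      exact h1.trans (anc_reach hg (hρ1 v)).symm
  have hJm : ∀ α, J.orderEmbOfFin hJ α ∈ J := fun b => Finset.orderEmbOfFin_mem J hJ b
  have hIρ : ∀ α, ρ (I.orderEmbOfFin hI (σ α)) = J.orderEmbOfFin hJ α := fun α =>
    hρ5 _ _ (hσ α) (hgJ _ (hJm α))
  have hIs : ∀ u ∈ I, ∃ α, u = I.orderEmbOfFin hI (σ α) := by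
    intro u hu
    have : u ∈ Set.range (I.orderEmbOfFin hI) := by
      rw [Finset.range_orderEmbOfFin]; exact hu
    obtain ⟨b, rfl⟩ := this
    exact ⟨σ.symm b, by simp⟩
  have hJs : ∀ u ∈ J, ∃ α, u = J.orderEmbOfFin hJ α := by
    intro u hu
    have : u ∈ Set.range (J.orderEmbOfFin hJ) := by
      rw [Finset.range_orderEmbOfFin]; exact hu
    obtain ⟨b, rfl⟩ := this
    exact ⟨b, rfl⟩
  have hρJ : ∀ j ∈ J, ρ j = j := fun j hj => hρ4 j (hgJ j hj)
  have touch : ∀ v, (∃ u ∈ I ∪ J, (forestGraph (Fg g)).Reachable v u) ↔ ρ v ∈ J := by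
    intro v
    constructor
    · rintro ⟨u, hu, h⟩
      rw [hreach] at h
      rw [h]
      rcases Finset.mem_union.1 hu with h1 | h1
      · obtain ⟨α, rfl⟩ := hIs u h1
        rw [hIρ]; exact hJm α
      · rw [hρJ u h1]; exact h1
    · intro h
      exact ⟨ρ v, Finset.mem_union_right _ h, (hreach _ _).2 (hρJ _ h).symm⟩
  refine ⟨⟨⟨⟨?_, ?_, acyclic_Fg hg⟩, ?_, fun j hj => oriented_Fg hg (hgJ j hj)⟩, ?_, ?_, ?_⟩, ?_⟩
  · obtain ⟨h, hh, h0⟩ := hg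
    rintro ⟨u, v⟩ he huv
    have := hh _ _ (mem_Fg.1 he)
    simp only at huv
    subst huv
    omega
  · obtain ⟨h, hh, h0⟩ := hg
    rintro ⟨u, v⟩ he huv
    have h1 := hh _ _ (mem_Fg.1 he)
    have h2 := hh _ _ (mem_Fg.1 huv)
    simp only at h1 h2
    omega
  · intro v hv
    rw [touch] at hv
    obtain ⟨α, hα⟩ := hJs _ hv
    constructor
    · refine ⟨I.orderEmbOfFin hI (σ α), ⟨Finset.orderEmbOfFin_mem I hI _, ?_⟩, ?_⟩
      · rw [hreach, hIρ, hα]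
      · rintro u ⟨hu, hvu⟩
        obtain ⟨β, rfl⟩ := hIs u hu
        rw [hreach, hIρ, hα] at hvu
        have : α = β := (J.orderEmbOfFin hJ).injective hvu
        rw [this]
    · refine ⟨ρ v, ⟨hv, ?_⟩, ?_⟩
      · rw [hreach, hρJ _ hv]
      · rintro u ⟨hu, hvu⟩
        rw [hreach, hρJ u hu] at hvu
        exact hvu.symm
  · intro v hv
    rw [touch] at hv
    refine ⟨ρ v, ⟨by simp [Rg, hv, hρ2], ?_⟩, ?_⟩
    · rw [hreach, hρ4 _ (hρ2 v)]
    · rintro u ⟨hu, hvu⟩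
      simp only [Rg, Finset.mem_filter, Finset.mem_univ, true_and] at hu
      rw [hreach, hρ4 u hu.2] at hvu
      exact hvu.symm
  · intro r hr
    simp only [Rg, Finset.mem_filter, Finset.mem_univ, true_and] at hr
    rw [touch, hρ4 r hr.2]
    exact hr.1
  · intro r hr
    simp only [Rg, Finset.mem_filter, Finset.mem_univ, true_and] at hr
    exact oriented_Fg hg hr.2
  · intro α
    exact (anc_reach hg (hσ α)).symm

lemma admissible_good {n p : ℕ} (I J : Finset (Fin n)) (hI : I.card = p) (hJ : J.card = p)
    (σ : Equiv.Perm (Fin p)) (F : Finset (Fin n × Fin n)) (Rt : Finset (Fin n))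
    (hA : AdmissiblePair I J F Rt) (hM : MatchPerm I J hI hJ F σ) :
    ∃ g : Fin n → Option (Fin n), Acyc g ∧ (∀ j ∈ J, g j = none) ∧
    (∀ α, Anc g (I.orderEmbOfFin hI (σ α)) (J.orderEmbOfFin hJ α)) ∧
    Fg g = F ∧ Rg J g = Rt := by
  obtain ⟨⟨⟨hloop, hrev, hac⟩, hIJ, hoJ⟩, hR1, hR2, hR3⟩ := hA
  set G := forestGraph F with hG
  have hdisj : ∀ r ∈ Rt, r ∉ J := fun r hr hj =>
    hR2 r hr ⟨r, Finset.mem_union_right _ hj, SimpleGraph.Reachable.refl _⟩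
  have hroot : ∀ v, ∃ s, (s ∈ J ∨ s ∈ Rt) ∧ G.Reachable v s ∧
      ∀ s', (s' ∈ J ∨ s' ∈ Rt) → G.Reachable v s' → s' = s := by
    intro v
    by_cases hv : ∃ u ∈ I ∪ J, G.Reachable v u
    · obtain ⟨s, ⟨hs1, hs2⟩, hs3⟩ := (hIJ v hv).2
      refine ⟨s, Or.inl hs1, hs2, ?_⟩
      rintro s' (hs' | hs') hr
      · exact hs3 s' ⟨hs', hr⟩
      · obtain ⟨u, hu, hvu⟩ := hv
        exact absurd ⟨u, hu, hr.symm.trans hvu⟩ (hR2 s' hs')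
    · obtain ⟨s, ⟨hs1, hs2⟩, hs3⟩ := hR1 v hv
      refine ⟨s, Or.inr hs1, hs2, ?_⟩
      rintro s' (hs' | hs') hr
      · exact absurd ⟨s', Finset.mem_union_right _ hs', hr⟩ hv
      · exact hs3 s' ⟨hs', hr⟩
  choose ρ hρ1 hρ2 hρ3 using hroot
  have hor : ∀ s, (s ∈ J ∨ s ∈ Rt) → OrientedAway F s := by
    rintro s (h | h)
    · exact hoJ s h
    · exact hR3 s h
  have hρadj : ∀ x y, G.Reachable x y → ρ x = ρ y := fun x y h =>
    hρ3 y _ (hρ1 x) (h.symm.trans (hρ2 x))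
  have hρself : ∀ s, (s ∈ J ∨ s ∈ Rt) → ρ s = s := fun s hs =>
    (hρ3 s s hs (SimpleGraph.Reachable.refl _)).symm
  set h : Fin n → ℕ := fun v => G.dist (ρ v) v with hh
  have hadj : ∀ u v, (u, v) ∈ F → G.Adj u v := fun u v huv =>
    forest_adj.2 ⟨hloop _ huv, Or.inl huv⟩
  have hedge : ∀ u v, (u, v) ∈ F → h v = h u + 1 := by
    intro u v huv
    have h1 : ρ v = ρ u := (hρadj _ _ (hadj u v huv).reachable).symm
    simp only [hh, h1]
    exact hor _ (hρ1 u) (u, v) huv (hρ2 u).symm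
  have hh0 : ∀ s, (s ∈ J ∨ s ∈ Rt) → h s = 0 := by
    intro s hs
    simp [hh, hρself s hs]
  have hdown : ∀ x, h x ≠ 0 → ∃ y, (y, x) ∈ F := by
    intro x hx
    obtain ⟨w, hw⟩ := (hρ2 x).exists_walk_length_eq_dist
    have hw' : w.length = h x := by rw [hw, SimpleGraph.dist_comm]
    generalize hr : ρ x = r at w
    cases w with
    | nil => simp at hw'; omega
    | @cons _ y _ hxy w' =>
      refine ⟨y, ?_⟩
      rcases (forest_adj.1 hxy).2 with h1 | h1
      · exfalso
        have h2 := hedge _ _ h1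
        have h3 : h y ≤ w'.length := by
          have h4 : ρ y = r := by rw [← hρadj _ _ hxy.reachable, hr]
          simp only [hh, h4]
          rw [SimpleGraph.dist_comm]
          exact SimpleGraph.dist_le w'
        rw [SimpleGraph.Walk.length_cons] at hw'
        omega
      · exact h1
  have hz : ∀ x, h x = 0 → (x ∈ J ∨ x ∈ Rt) := by
    intro x hx
    have : ρ x = x := ((hρ2 x).symm.dist_eq_zero_iff).1 hx
    rw [← this]; exact hρ1 x
  have huniq : ∀ u u' v, (u, v) ∈ F → (u', v) ∈ F → u = u' := by
    intro u u' v h1 h2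
    by_contra hne
    have hb := (SimpleGraph.isAcyclic_iff_forall_adj_isBridge.1 hac) (hadj u v h1)
    rw [SimpleGraph.isBridge_iff] at hb
    have hup : ∀ k x, h x = k → h x < h v → (G.deleteEdges {s(u, v)}).Reachable (ρ x) x := by
      intro k
      induction k with
      | zero =>
        intro x hx _
        rw [hρself x (hz x hx)]
      | succ k ih =>
        intro x hx hxv
        obtain ⟨y, hy⟩ := hdown x (by omega)
        have hyx := hedge _ _ hy
        have h3 := ih y (by omega) (by omega)
        rw [← hρadj _ _ (hadj _ _ hy).reachable]
        refine h3.trans (SimpleGraph.Adj.reachable ?_)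
        rw [SimpleGraph.deleteEdges_adj]
        refine ⟨hadj _ _ hy, ?_⟩
        simp only [Set.mem_singleton_iff, Sym2.eq_iff, not_or, not_and]
        constructor
        · rintro rfl rfl; omega
        · rintro rfl; omega
    have e1 := hedge _ _ h1
    have e2 := hedge _ _ h2
    have r1 := hup _ u rfl (by omega)
    have r2 := hup _ u' rfl (by omega)
    rw [hρadj _ _ (hadj _ _ h1).reachable] at r1
    rw [hρadj _ _ (hadj _ _ h2).reachable] at r2
    apply hb
    refine r1.symm.trans (r2.trans (SimpleGraph.Adj.reachable ?_))
    rw [SimpleGraph.deleteEdges_adj]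
    refine ⟨hadj _ _ h2, ?_⟩
    simp only [Set.mem_singleton_iff, Sym2.eq_iff, not_or, not_and]
    constructor
    · intro h; exact absurd h.symm hne
    · rintro rfl; omega
  let g : Fin n → Option (Fin n) := fun v =>
    if hv : ∃ u, (u, v) ∈ F then some hv.choose else none
  have hg1 : ∀ u v, g v = some u ↔ (u, v) ∈ F := by
    intro u v
    simp only [g]
    split_ifs with hv
    · rw [Option.some.injEq]
      constructor
      · rintro rfl; exact hv.choose_spec
      · intro h; exact huniq _ _ _ hv.choose_spec h
    · simp only [reduceCtorEq, false_iff]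
      exact fun h => hv ⟨u, h⟩
  have hg2 : ∀ v, g v = none ↔ (v ∈ J ∨ v ∈ Rt) := by
    intro v
    constructor
    · intro hv
      apply hz
      by_contra hne
      obtain ⟨y, hy⟩ := hdown v hne
      rw [(hg1 y v).2 hy] at hv; cases hv
    · intro hv
      rcases hgv : g v with _ | u
      · rfl
      · have := hedge _ _ ((hg1 _ _).1 hgv)
        have := hh0 v hv
        omega
  have hanc : ∀ k x, h x = k → Anc g x (ρ x) := by
    intro k
    induction k with
    | zero =>
      intro x hx
      rw [hρself x (hz x hx)]
    | succ k ih =>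
      intro x hx
      obtain ⟨y, hy⟩ := hdown x (by omega)
      have := hedge _ _ hy
      have h3 := ih y (by omega)
      rw [← hρadj _ _ (hadj _ _ hy).reachable]
      exact Relation.ReflTransGen.head ((hg1 _ _).2 hy) h3
  refine ⟨g, ⟨h, ?_, ?_⟩, ?_, ?_, ?_, ?_⟩
  · intro j i hji
    exact hedge _ _ ((hg1 _ _).1 hji)
  · intro j hj
    exact hh0 j ((hg2 j).1 hj)
  · intro j hj
    exact (hg2 j).2 (Or.inl hj)
  · intro α
    have h1 : G.Reachable (J.orderEmbOfFin hJ α) (I.orderEmbOfFin hI (σ α)) := hM α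
    have h2 := hρadj _ _ h1
    rw [hρself _ (Or.inl (Finset.orderEmbOfFin_mem J hJ α))] at h2
    have h3 := hanc _ (I.orderEmbOfFin hI (σ α)) rfl
    rw [← h2] at h3
    exact h3
  · ext ⟨u, v⟩
    rw [mem_Fg, hg1]
  · ext v
    simp only [Rg, Finset.mem_filter, Finset.mem_univ, true_and, hg2]
    constructor
    · rintro ⟨h1, h2⟩; exact h2.resolve_left h1
    · intro h; exact ⟨hdisj v h, Or.inr h⟩

def wt {K : Type*} [CommRing K] {n : ℕ} (A : Matrix (Fin n) (Fin n) K) (J : Finset (Fin n))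
    (j : Fin n) (o : Option (Fin n)) : K :=
  match o with
  | none => if j ∈ J then 1 else ∑ i, A i j
  | some i => if j ∈ J then 0 else - A i j

lemma det_expand {K : Type*} [CommRing K] {n : ℕ} (A : Matrix (Fin n) (Fin n) K)
    (J : Finset (Fin n)) (τ : Equiv.Perm (Fin n)) :
    Matrix.det (Matrix.of fun k j => if j ∈ J then (Pi.single (τ j) 1 : Fin n → K) k
      else A k j) =
    ∑ g : Fin n → Option (Fin n), (∏ j, wt A J j (g j)) *
      (matB J τ g : Matrix (Fin n) (Fin n) K).det := by
  have hcol : (Matrix.of fun k j => if j ∈ J then (Pi.single (τ j) 1 : Fin n → K) k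
      else A k j).transpose = fun j => ∑ o : Option (Fin n), wt A J j o • colB J τ j o := by
    funext j
    rw [Fintype.sum_option]
    by_cases hj : j ∈ J
    · ext k
      simp [wt, colB, hj]
    · ext k
      simp [wt, colB, hj, Finset.sum_apply, Pi.single_apply, mul_sub, Finset.sum_ite_eq]
  rw [← Matrix.det_transpose, hcol]
  have h1 := (Matrix.detRowAlternating (R := K) (n := Fin n)).toMultilinearMap.map_sum
    (fun (j : Fin n) (o : Option (Fin n)) => wt A J j o • colB J τ j o)
  refine Eq.trans h1 ?_
  refine Finset.sum_congr rfl fun g _ => ?_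
  rw [MultilinearMap.map_smul_univ, smul_eq_mul, ← Matrix.det_transpose (matB J τ g)]
  rfl

lemma wt_zero {K : Type*} [CommRing K] {n : ℕ} (A : Matrix (Fin n) (Fin n) K)
    (J : Finset (Fin n)) (g : Fin n → Option (Fin n)) (hg : ¬ ∀ j ∈ J, g j = none) :
    ∏ j, wt A J j (g j) = 0 := by
  push Not at hg
  obtain ⟨j, hj, h⟩ := hg
  apply Finset.prod_eq_zero (Finset.mem_univ j)
  obtain ⟨i, hi⟩ := Option.ne_none_iff_exists'.1 h
  simp [wt, hi, hj]

lemma wt_prod {K : Type*} [CommRing K] {n : ℕ} (A : Matrix (Fin n) (Fin n) K)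
    (J : Finset (Fin n)) (g : Fin n → Option (Fin n)) (hg : ∀ j ∈ J, g j = none) :
    ∏ j, wt A J j (g j) = (∏ j ∈ Rg J g, ∑ i, A i j) * ∏ e ∈ Fg g, (-(A e.1 e.2)) := by
  rw [Rg, Fg, Finset.prod_filter, Finset.prod_filter, Fintype.prod_prod_type_right,
    ← Finset.prod_mul_distrib]
  refine Finset.prod_congr rfl fun j _ => ?_
  rcases hgj : g j with _ | i
  · by_cases hj : j ∈ J <;> simp [wt, hj, hgj]
  · have hj : j ∉ J := fun h => by rw [hg j h] at hgj; cases hgj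
    simp [wt, hj, hgj]

lemma main_aux {K : Type*} [CommRing K] {n p q : ℕ} (A : Matrix (Fin n) (Fin n) K)
    (I J : Finset (Fin n))
    (hI : I.card = p) (hJ : J.card = p) (hI' : Iᶜ.card = q) (hJ' : Jᶜ.card = q) :
    Matrix.det (fun (a b : Fin q) => A (Iᶜ.orderEmbOfFin hI' a) (Jᶜ.orderEmbOfFin hJ' b)) =
      (-1 : K) ^ ((∑ i ∈ I, ((i : ℕ) + 1)) + ∑ j ∈ J, ((j : ℕ) + 1)) *
        ∑ F : Finset (Fin n × Fin n), ∑ Rt : Finset (Fin n), ∑ σ : Equiv.Perm (Fin p),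
          if AdmissiblePair I J F Rt ∧ MatchPerm I J hI hJ F σ then
            ((Equiv.Perm.sign σ : ℤ) : K) * (∏ j ∈ Rt, (∑ i : Fin n, A i j)) *
              ∏ e ∈ F, (-(A e.1 e.2))
          else 0 := by
  rw [minor_eq A I J hI hJ hI' hJ', det_expand]
  congr 1
  have step : ∀ g : Fin n → Option (Fin n), (∏ j, wt A J j (g j)) *
      (matB J ((finSumEquivOfFinset hJ hJ').symm.trans (finSumEquivOfFinset hI hI')) g :
        Matrix (Fin n) (Fin n) K).det =
      ∑ σ : Equiv.Perm (Fin p), if (Acyc g ∧ (∀ j ∈ J, g j = none) ∧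
        ∀ α, Anc g (I.orderEmbOfFin hI (σ α)) (J.orderEmbOfFin hJ α)) then
        ((Equiv.Perm.sign σ : ℤ) : K) * (∏ j ∈ Rg J g, (∑ i : Fin n, A i j)) *
              ∏ e ∈ Fg g, (-(A e.1 e.2)) else 0 := by
    intro g
    by_cases h1 : ∀ j ∈ J, g j = none
    · by_cases h2 : Acyc g
      · rw [det_acyclic J I hI hJ hI' hJ' g h2 h1, wt_prod A J g h1, Finset.mul_sum]
        refine Finset.sum_congr rfl fun σ _ => ?_
        by_cases h3 : ∀ α, Anc g (I.orderEmbOfFin hI (σ α)) (J.orderEmbOfFin hJ α)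
        · rw [if_pos h3, if_pos ⟨h2, h1, h3⟩]; ring
        · rw [if_neg h3, if_neg (fun h => h3 h.2.2)]; ring
      · rw [det_cyclic _ _ _ h2, mul_zero]
        symm
        exact Finset.sum_eq_zero fun σ _ => if_neg fun h => h2 h.1
    · rw [wt_zero A J g h1, zero_mul]
      symm
      exact Finset.sum_eq_zero fun σ _ => if_neg fun h => h1 h.2.1
  simp only [step]
  rw [Finset.sum_comm]
  refine Eq.trans ?_ (Fintype.sum_prod_type (fun x : Finset (Fin n × Fin n) × Finset (Fin n) =>
    ∑ σ : Equiv.Perm (Fin p),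
          if AdmissiblePair I J x.1 x.2 ∧ MatchPerm I J hI hJ x.1 σ then
            ((Equiv.Perm.sign σ : ℤ) : K) * (∏ j ∈ x.2, (∑ i : Fin n, A i j)) *
              ∏ e ∈ x.1, (-(A e.1 e.2))
          else 0))
  rw [Finset.sum_comm (s := Finset.univ (α := Finset (Fin n × Fin n) × Finset (Fin n)))]
  refine Finset.sum_congr rfl fun σ _ => ?_
  rw [← Finset.sum_filter, ← Finset.sum_filter]
  refine Finset.sum_bij (fun g _ => (Fg g, Rg J g)) ?_ ?_ ?_ ?_
  · intro g hg
    obtain ⟨h1, h2, h3⟩ := (Finset.mem_filter.1 hg).2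
    exact Finset.mem_filter.2 ⟨Finset.mem_univ _, good_admissible I J hI hJ σ g h1 h2 h3⟩
  · intro g _ g' _ heq
    have hF : Fg g = Fg g' := congrArg Prod.fst heq
    funext v
    apply Option.ext
    intro u
    rw [← mem_Fg, ← mem_Fg, hF]
  · rintro ⟨F, Rt⟩ hF
    obtain ⟨h1, h2⟩ := (Finset.mem_filter.1 hF).2
    obtain ⟨g, a, b, c, d, e⟩ := admissible_good I J hI hJ σ F Rt h1 h2
    exact ⟨g, Finset.mem_filter.2 ⟨Finset.mem_univ _, a, b, c⟩, by rw [d, e]⟩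
  · intro g _
    rfl

/-- The massive all-minors matrix-tree theorem:
`det (A_{Iᶜ,Jᶜ}) = (-1)^(ΣI+ΣJ) Σ_{(F,R) admissible} ε(F) Π_{j∈R} (Σ_i Aᵢⱼ) Π_{(i,j)∈F} (-Aᵢⱼ)`
(1-based index sums; the sum over the matching permutation `σ` has a unique admissible
term, whose sign is `ε(F)`). -/
theorem massive_all_minors_matrix_tree (n p : ℕ) (A : Matrix (Fin n) (Fin n) R)
    (I J : Finset (Fin n)) (hI : I.card = p) (hJ : J.card = p) :
    Matrix.det (fun (a b : Fin (n - p)) =>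
        A ((Iᶜ.orderIsoOfFin (by simp [Finset.card_compl, hI])) a)
          ((Jᶜ.orderIsoOfFin (by simp [Finset.card_compl, hJ])) b)) =
      (-1 : R) ^ ((∑ i ∈ I, ((i : ℕ) + 1)) + ∑ j ∈ J, ((j : ℕ) + 1)) *
        ∑ F : Finset (Fin n × Fin n), ∑ Rt : Finset (Fin n), ∑ σ : Equiv.Perm (Fin p),
          if AdmissiblePair I J F Rt ∧ MatchPerm I J hI hJ F σ then
            ((Equiv.Perm.sign σ : ℤ) : R) * (∏ j ∈ Rt, (∑ i : Fin n, A i j)) *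
              ∏ e ∈ F, (-(A e.1 e.2))
          else 0 := by
  exact main_aux A I J hI hJ (by simp [Finset.card_compl, hI]) (by simp [Finset.card_compl, hJ])
end
end

section
/- If the undirected multigraph associated to a set F of directed edges on {1,…,n} contains a cycle (i.e. there exist k ≥ 3 and an injective map τ: ℤ/kℤ → {1,…,n} with (τ(α),τ(α+1)) or (τ(α+1),τ(α)) in F for all α), then any product in the exterior algebra containing the factors (ψ̄ᵢ−ψ̄ⱼ) for each (i,j)∈F vanishes; in particular Π_{(i,j)∈F} (ψ̄ᵢ−ψ̄ⱼ) = 0. -/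
set_option synthInstance.maxHeartbeats 1000000
set_option maxHeartbeats 1000000

noncomputable section

variable {R : Type*} [CommRing R] [Algebra ℚ R]

theorem aux_alt {R M N : Type*} [CommRing R] [AddCommGroup M] [Module R M] [AddCommGroup N]
    [Module R N] {ι : Type*} [DecidableEq ι] (f : M [⋀^ι]→ₗ[R] N) (w : ι → M) (i : ι)
    (h : w i ∈ Submodule.span R (w '' {j | j ≠ i})) : f w = 0 := by
  have key : ∀ x ∈ Submodule.span R (w '' {j | j ≠ i}), f (Function.update w i x) = 0 := by
    intro x hx
    induction hx using Submodule.span_induction with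
    | mem x hx =>
      obtain ⟨j, hj, rfl⟩ := hx
      exact f.map_update_self w (Ne.symm hj)
    | zero => exact f.map_update_zero w i
    | add x y _ _ hx hy => rw [f.map_update_add, hx, hy, add_zero]
    | smul a x _ hx => rw [f.map_update_smul, hx, smul_zero]
  simpa using key _ h

theorem aux_list {R M A : Type*} [CommRing R] [AddCommGroup M] [Module R M]
    (l : List A) (hl : l.Nodup) (v : A → M) (a : A) (ha : a ∈ l)
    (h : v a ∈ Submodule.span R (v '' {b | b ∈ l ∧ b ≠ a})) :
    (l.map (fun e => ExteriorAlgebra.ι R (v e))).prod = 0 := by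
  obtain ⟨i, rfl⟩ := List.get_of_mem ha
  have h1 : ExteriorAlgebra.ιMulti R l.length (fun i => v (l.get i)) = 0 := by
    apply aux_alt _ _ i
    refine Submodule.span_mono ?_ h
    rintro _ ⟨b, ⟨hb, hne⟩, rfl⟩
    obtain ⟨j, rfl⟩ := List.get_of_mem hb
    exact ⟨j, fun hj => hne (by rw [hj]), rfl⟩
  rw [ExteriorAlgebra.ιMulti_apply] at h1
  rw [← h1]
  congr 1
  apply List.ext_get <;> simp

/-- If the undirected multigraph underlying a set `F` of directed edges contains a cycle,
then the product of the corresponding difference factors `(ψ̄ᵢ - ψ̄ⱼ)`, `(i,j) ∈ F`,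
vanishes in the Grassmann algebra. -/
theorem cycle_product_vanishes (n k : ℕ) (hk : 3 ≤ k) (F : Finset (Fin n × Fin n))
    (τ : ZMod k → Fin n) (hτ : Function.Injective τ)
    (hcyc : ∀ α : ZMod k, (τ α, τ (α + 1)) ∈ F ∨ (τ (α + 1), τ α) ∈ F) :
    ((F.toList.map (fun e => (gaGen e.1 : GA R (Fin n)) - gaGen e.2)).prod : GA R (Fin n)) = 0 := by
  classical
  haveI : NeZero k := ⟨by omega⟩
  haveI : Fact (1 < k) := ⟨by omega⟩
  let v : Fin n × Fin n → (Fin n → R) := fun e => Pi.single e.1 1 - Pi.single e.2 1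
  have hv : (fun e : Fin n × Fin n => (gaGen e.1 : GA R (Fin n)) - gaGen e.2)
      = fun e => ExteriorAlgebra.ι R (v e) := by
    funext e
    simp only [gaGen, v, map_sub]
  rw [hv]
  let u : ZMod k → (Fin n → R) := fun α => Pi.single (τ (α + 1)) 1 - Pi.single (τ α) 1
  have hu : ∑ α, u α = 0 := by
    simp only [u, Finset.sum_sub_distrib]
    rw [sub_eq_zero]
    exact Equiv.sum_comp (Equiv.addRight (1 : ZMod k)) (fun α => (Pi.single (τ α) 1 : Fin n → R))
  have he : ∀ α, ∃ e ∈ F, (e = (τ α, τ (α + 1)) ∧ v e = - u α) ∨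
      (e = (τ (α + 1), τ α) ∧ v e = u α) := by
    intro α
    rcases hcyc α with h | h
    · exact ⟨_, h, Or.inl ⟨rfl, by simp [v, u]⟩⟩
    · exact ⟨_, h, Or.inr ⟨rfl, rfl⟩⟩
  choose e heF he using he
  have h2 : (1 : ZMod k) + 1 ≠ 0 := by
    intro h
    have h' : ((2 : ℕ) : ZMod k) = 0 := by push_cast; rw [← h]; norm_num
    rw [ZMod.natCast_eq_zero_iff] at h'
    have := Nat.le_of_dvd (by norm_num) h'
    omega
  have hne : ∀ α, α ≠ 0 → e α ≠ e 0 := by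
    intro α hα heq
    rcases he α with ⟨h, -⟩ | ⟨h, -⟩ <;> rcases he 0 with ⟨h', -⟩ | ⟨h', -⟩ <;>
      rw [h, h', Prod.mk.injEq] at heq <;> obtain ⟨ha, hb⟩ := heq <;>
      have ha := hτ ha <;> have hb := hτ hb
    · exact hα ha
    · rw [ha, zero_add] at hb
      exact h2 hb
    · rw [hb, zero_add] at ha
      exact h2 ha
    · exact hα hb
  apply aux_list _ F.nodup_toList v (e 0) (Finset.mem_toList.2 (heF 0))
  have hu0 : u 0 ∈ Submodule.span R (v '' {b | b ∈ F.toList ∧ b ≠ e 0}) := by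
    rw [← Finset.add_sum_erase _ _ (Finset.mem_univ (0 : ZMod k))] at hu
    rw [eq_neg_of_add_eq_zero_left hu]
    refine Submodule.neg_mem _ (Submodule.sum_mem _ fun α hα => ?_)
    have hm : v (e α) ∈ Submodule.span R (v '' {b | b ∈ F.toList ∧ b ≠ e 0}) :=
      Submodule.subset_span
        ⟨e α, ⟨Finset.mem_toList.2 (heF α), hne α (Finset.ne_of_mem_erase hα)⟩, rfl⟩
    rcases he α with ⟨-, h⟩ | ⟨-, h⟩ <;> rw [h] at hm
    · exact (Submodule.neg_mem_iff _).1 hm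
    · exact hm
  rcases he 0 with ⟨-, h⟩ | ⟨-, h⟩ <;> rw [h]
  · exact Submodule.neg_mem _ hu0
  · exact hu0
end
end

section
/- For odd k and distinct indices α₁,…,α_k, the following identity holds in the exterior algebra: (χ_{α₁}−χ_{α₂})(χ_{α₁}−χ_{α₃})⋯(χ_{α₁}−χ_{α_k}) = Σ_{μ=1}^{k} χ_{α_{μ+1}}⋯χ_{α_k} χ_{α₁}⋯χ_{α_{μ−1}}, i.e. the expansion yields all cyclic shifts of the monomial χ_{α₂}⋯χ_{α_k} over the full cyclic sequence (α₁,…,α_k). -/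
set_option synthInstance.maxHeartbeats 1000000
set_option maxHeartbeats 1000000

noncomputable section

variable {R : Type*} [CommRing R] [Algebra ℚ R]

theorem cyc_move {A : Type*} [Ring A] (z : A) (y : ℕ → A) (h : ∀ i, z * y i = - (y i * z)) (p : ℕ) :
    z * ((List.range p).map y).prod = (-1) ^ p * (((List.range p).map y).prod * z) := by
  induction p with
  | zero => simp
  | succ p ih =>
    rw [List.range_succ, List.map_append, List.prod_append, ← mul_assoc, ih]
    simp only [List.map_cons, List.map_nil, List.prod_cons, List.prod_nil, mul_one, mul_assoc, h p,
      pow_succ]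
    simp [mul_assoc]

theorem cyc_px {A : Type*} [Ring A] (x : A) (y : ℕ → A) (hx : x * x = 0)
    (hxy : ∀ i, x * y i = - (y i * x)) (m : ℕ) :
    ((List.range m).map (fun j => x - y j)).prod * x = x * ((List.range m).map y).prod := by
  induction m with
  | zero => simp
  | succ m ih =>
    have h1 : (x - y m) * x = x * y m := by rw [sub_mul, hx, hxy]; simp
    rw [List.range_succ, List.map_append, List.prod_append, List.map_append, List.prod_append]
    simp only [List.map_cons, List.map_nil, List.prod_cons, List.prod_nil, mul_one]
    rw [mul_assoc, h1, ← mul_assoc, ih, mul_assoc]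

theorem cyc_main {A : Type*} [Ring A] (x : A) (y : ℕ → A) (hx : x * x = 0)
    (hxy : ∀ i, x * y i = - (y i * x)) (hyy : ∀ i j, y i * y j = - (y j * y i)) (m : ℕ) :
    ((List.range m).map (fun j => x - y j)).prod =
      (-1) ^ m * ((List.range m).map y).prod + ∑ i ∈ Finset.range m, (-1) ^ (i * m) *
        (((List.range (m - 1 - i)).map (fun t => y (i + 1 + t))).prod *
          (x * ((List.range i).map y).prod)) := by
  induction m with
  | zero => simp
  | succ m ih =>
    have e1 : ((List.range (m+1)).map (fun j => x - y j)).prod =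
        x * ((List.range m).map y).prod - ((List.range m).map (fun j => x - y j)).prod * y m := by
      rw [← cyc_px x y hx hxy, List.range_succ, List.map_append, List.prod_append]
      simp [mul_sub]
    have e2 : ((List.range (m+1)).map y).prod = ((List.range m).map y).prod * y m := by
      rw [List.range_succ, List.map_append, List.prod_append]
      simp
    rw [e1, ih, e2, Finset.sum_range_succ, add_mul, Finset.sum_mul]
    have e3 : (-1 : A) ^ (m * (m + 1)) = 1 := (Nat.even_mul_succ_self m).neg_one_pow
    have e4 : ∑ i ∈ Finset.range m, (-1) ^ (i * (m + 1)) *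
        (((List.range (m + 1 - 1 - i)).map (fun t => y (i + 1 + t))).prod *
          (x * ((List.range i).map y).prod)) = - ∑ i ∈ Finset.range m, (-1) ^ (i * m) *
        (((List.range (m - 1 - i)).map (fun t => y (i + 1 + t))).prod *
          (x * ((List.range i).map y).prod)) * y m := by
      rw [← Finset.sum_neg_distrib]
      refine Finset.sum_congr rfl fun i hi => ?_
      have hi := Finset.mem_range.mp hi
      have h1 : m + 1 - 1 - i = (m - 1 - i) + 1 := by omega
      have h2 : i + 1 + (m - 1 - i) = m := by omega
      rw [h1, List.range_succ, List.map_append, List.prod_append]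
      simp only [List.map_cons, List.map_nil, List.prod_cons, List.prod_nil, mul_one, h2]
      generalize ((List.range (m - 1 - i)).map (fun t => y (i + 1 + t))).prod = B
      have h3 := cyc_move (y m) y (hyy m) i
      generalize ((List.range i).map y).prod = C at *
      have h4 : y m * (x * C) = - ((-1) ^ i * (x * (C * y m))) := by
        rw [← mul_assoc, ← neg_eq_iff_eq_neg.mpr (hxy m), neg_mul, mul_assoc, h3]
        rcases neg_one_pow_eq_or A i with h | h <;> rw [h] <;> simp
      rw [mul_assoc B, h4, mul_add, pow_add]
      rcases neg_one_pow_eq_or A i with h | h <;> rw [mul_one, h] <;> simp [mul_assoc]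
    rw [e4, e3]
    simp [pow_succ, mul_assoc]
    abel

theorem cyc_split {A : Type*} [Ring A] (g : ℕ → A) (m i : ℕ) (hi : i < m) :
    ((List.range m).map (fun t => g ((i + 1 + t + 1) % (m + 1)))).prod =
      ((List.range (m - 1 - i)).map (fun t => g ((i + 1 + t + 1) % (m + 1)))).prod *
          (g 0 * ((List.range i).map (fun j => g ((j + 1) % (m + 1)))).prod) := by
  have h1 : m = (m - 1 - i) + (1 + i) := by omega
  have h2 : List.range m = List.range ((m - 1 - i) + (1 + i)) := congrArg _ h1
  rw [h2, List.range_add, List.range_add, List.map_append, List.prod_append]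
  congr 1
  rw [List.map_append, List.map_append, List.prod_append]
  congr 1
  · have : i + 1 + (m - 1 - i) + 1 = m + 1 := by omega
    simp [this]
  · simp only [List.map_map]
    congr 1
    refine List.map_congr_left fun s _ => ?_
    have : i + 1 + (m - 1 - i + (1 + s)) + 1 = (s + 1) + (m + 1) := by omega
    simp [Function.comp, this]

theorem cyc_ofFn {A : Type*} (m : ℕ) (f : ℕ → A) :
    List.ofFn (fun j : Fin m => f j) = (List.range m).map f := by
  apply List.ext_getElem <;> simp

theorem gaGen_anti {R : Type*} [CommRing R] {ι : Type*} [DecidableEq ι] (i j : ι) :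
    (gaGen i : GA R ι) * gaGen j = - (gaGen j * gaGen i) :=
  eq_neg_of_add_eq_zero_left (ExteriorAlgebra.ι_add_mul_swap _ _)

/-- For odd `k` and distinct indices `α₁,…,α_k`,
`(χ_{α₁}-χ_{α₂})⋯(χ_{α₁}-χ_{α_k}) = Σ_{μ=1}^k χ_{α_{μ+1}}⋯χ_{α_k}χ_{α₁}⋯χ_{α_{μ-1}}`,
the sum of all cyclic shifts of the monomial omitting `χ_{α_μ}`. -/
theorem cyclic_expansion (n k : ℕ) (hk3 : 3 ≤ k) (hkn : k ≤ n) (hodd : Odd k)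
    (α : Fin k → Fin n) (hα : Function.Injective α) :
    ((List.ofFn (fun j : Fin (k - 1) =>
        (gaGen (α ⟨0, by omega⟩) : GA R (Fin n)) - gaGen (α ⟨(j : ℕ) + 1, by omega⟩))).prod : GA R (Fin n)) =
      ∑ μ : Fin k, ((List.ofFn (fun t : Fin (k - 1) =>
        (gaGen (α ⟨((μ : ℕ) + (t : ℕ) + 1) % k, Nat.mod_lt _ μ.pos⟩) : GA R (Fin n)))).prod) := by
  obtain ⟨m, rfl⟩ : ∃ m, k = m + 1 := ⟨k - 1, by omega⟩
  have hm : Even m := by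
    rcases hodd with ⟨r, hr⟩
    exact ⟨r, by omega⟩
  let g : ℕ → GA R (Fin n) := fun j => gaGen (α ⟨j % (m + 1), Nat.mod_lt _ (Nat.succ_pos m)⟩)
  have hg : ∀ j, g (j % (m + 1)) = g j := fun j => by simp [g]
  have key := cyc_main (g 0) (fun j => g ((j + 1) % (m + 1)))
    (ExteriorAlgebra.ι_sq_zero _) (fun i => gaGen_anti _ _) (fun i j => gaGen_anti _ _) m
  have hL : List.ofFn (fun j : Fin (m + 1 - 1) =>
      (gaGen (α ⟨0, by omega⟩) : GA R (Fin n)) - gaGen (α ⟨(j : ℕ) + 1, by omega⟩)) =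
      (List.range m).map (fun j => g 0 - g ((j + 1) % (m + 1))) := by
    rw [← cyc_ofFn]
    refine congrArg List.ofFn (funext fun j => ?_)
    have : ((j : ℕ) + 1) % (m + 1) = j + 1 := Nat.mod_eq_of_lt (by have := j.2; omega)
    simp [g, this]
  have hR : ∀ μ : Fin (m + 1), List.ofFn (fun t : Fin (m + 1 - 1) =>
      (gaGen (α ⟨((μ : ℕ) + (t : ℕ) + 1) % (m + 1), Nat.mod_lt _ μ.pos⟩) : GA R (Fin n))) =
      (List.range m).map (fun t => g ((μ + t + 1) % (m + 1))) := by
    intro μ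
    rw [← cyc_ofFn]
    refine congrArg List.ofFn (funext fun j => ?_)
    simp [g]
  rw [hL, key]
  simp only [hR]
  rw [Fin.sum_univ_succ, hm.neg_one_pow, one_mul, Finset.sum_range]
  congr 1
  · simp
  · refine Finset.sum_congr rfl fun i _ => ?_
    rw [(hm.mul_left _).neg_one_pow, one_mul, Fin.val_succ, cyc_split g m i i.2]
end
end
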